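/- arXiv:math/0701219 — 7 statements merged into one kernel-verified Lean document; each statement's English description precedes it below -/
import Mathlib

section
/- Let α ∈ [0,1]. For all s, t > 0 and all x, y ∈ ℝ, the Chapman–Kolmogorov identity ∫_ℝ q_α(s,x,z)·q_α(t,z,y) dz = q_α(s+t,x,y) holds, i.e. the family (Q_t)_{t>0} is a semigroup. -/
open MeasureTheory Real Filter

/-- The Gaussian heat kernel `p(t,x,y) = (2πt)^{-1/2} exp(-(x-y)²/(2t))`. -/
noncomputable def heatKernel (t x y : ℝ) : ℝ :=
  (Real.sqrt (2 * Real.pi * t))⁻¹ * Real.exp (-(x - y) ^ 2 / (2 * t))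

/-- The transition kernel of the Skew Brownian motion of parameter `α`:
`q_α(t,x,y) = p(t,x,y) + (2α-1)·sgn(y)·(2πt)^{-1/2} exp(-(|x|+|y|)²/(2t))`. -/
noncomputable def skewKernel (α t x y : ℝ) : ℝ :=
  heatKernel t x y +
    (2 * α - 1) * Real.sign y * (Real.sqrt (2 * Real.pi * t))⁻¹ *
      Real.exp (-(|x| + |y|) ^ 2 / (2 * t))

theorem heatKernel_nonneg (t x y : ℝ) : 0 ≤ heatKernel t x y := by
  unfold heatKernel
  positivity

theorem heatKernel_comm (t x y : ℝ) : heatKernel t x y = heatKernel t y x := by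
  unfold heatKernel
  rw [show (x - y) ^ 2 = (y - x) ^ 2 by ring]

theorem heatKernel_neg_neg (t x y : ℝ) : heatKernel t (-x) (-y) = heatKernel t x y := by
  unfold heatKernel
  rw [show (-x - -y) ^ 2 = (x - y) ^ 2 by ring]

theorem heatKernel_neg_right (t x y : ℝ) : heatKernel t x (-y) = heatKernel t (-x) y := by
  rw [← heatKernel_neg_neg, neg_neg]

theorem heatKernel_eq_gaussianPDFReal {t : ℝ} (ht : 0 ≤ t) (x y : ℝ) :
    heatKernel t x y = ProbabilityTheory.gaussianPDFReal x ⟨t, ht⟩ y := by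
  rw [heatKernel_comm]
  rfl

theorem integrable_heatKernel {t : ℝ} (ht : 0 < t) (x : ℝ) : Integrable (heatKernel t x) := by
  simp_rw [funext (heatKernel_eq_gaussianPDFReal ht.le x)]
  exact ProbabilityTheory.integrable_gaussianPDFReal _ _

theorem integral_heatKernel {t : ℝ} (ht : 0 < t) (x : ℝ) : ∫ y, heatKernel t x y = 1 := by
  simp_rw [heatKernel_eq_gaussianPDFReal ht.le x]
  exact ProbabilityTheory.integral_gaussianPDFReal_eq_one _ fun h => ht.ne' (congrArg NNReal.toReal h)

/-- Completing the square in a product of two heat kernels. -/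
theorem heatKernel_mul_heatKernel {s t : ℝ} (hs : 0 < s) (ht : 0 < t) (x y z : ℝ) :
    heatKernel s x z * heatKernel t z y =
      heatKernel (s + t) x y * heatKernel (s * t / (s + t)) ((t * x + s * y) / (s + t)) z := by
  unfold heatKernel
  rw [mul_mul_mul_comm _ _ _ (Real.exp (-(z - y) ^ 2 / _)),
    mul_mul_mul_comm _ _ _ (Real.exp (-(_ - z) ^ 2 / _)), ← Real.exp_add, ← Real.exp_add, ← mul_inv, ← mul_inv,
    ← Real.sqrt_mul (by positivity), ← Real.sqrt_mul (by positivity)]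
  congr 1
  · congr 2
    field_simp
  · congr 1
    field_simp
    ring

theorem integrable_heatKernel_mul {s t : ℝ} (hs : 0 < s) (ht : 0 < t) (x y : ℝ) :
    Integrable fun z => heatKernel s x z * heatKernel t z y := by
  simp_rw [heatKernel_mul_heatKernel hs ht]
  exact (integrable_heatKernel (by positivity) _).const_mul _

theorem integral_heatKernel_mul {s t : ℝ} (hs : 0 < s) (ht : 0 < t) (x y : ℝ) :
    ∫ z, heatKernel s x z * heatKernel t z y = heatKernel (s + t) x y := by
  simp_rw [heatKernel_mul_heatKernel hs ht]
  rw [integral_const_mul, integral_heatKernel (by positivity), mul_one]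

theorem skewKernel_eq (α t x y : ℝ) :
    skewKernel α t x y =
      heatKernel t x y + (2 * α - 1) * Real.sign y * heatKernel t (-|x|) |y| := by
  unfold skewKernel heatKernel
  rw [show (-|x| - |y|) ^ 2 = (|x| + |y|) ^ 2 by ring]
  ring

theorem heatKernel_neg_abs_abs_le {t : ℝ} (ht : 0 < t) (x y : ℝ) :
    heatKernel t (-|x|) |y| ≤ heatKernel t x y := by
  unfold heatKernel
  have h : (x - y) ^ 2 ≤ (-|x| - |y|) ^ 2 := by
    rw [← sq_abs (x - y), show (-|x| - |y|) ^ 2 = (|x| + |y|) ^ 2 by ring]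
    gcongr
    exact abs_sub x y
  gcongr

theorem abs_skewKernel_le {α : ℝ} (hα : α ∈ Set.Icc (0 : ℝ) 1) {t : ℝ} (ht : 0 < t) (x y : ℝ) :
    |skewKernel α t x y| ≤ 2 * heatKernel t x y := by
  have hc : |2 * α - 1| ≤ 1 := abs_le.2 ⟨by linarith [hα.1], by linarith [hα.2]⟩
  have hsign : |Real.sign y| ≤ 1 := by
    rcases Real.sign_apply_eq y with h | h | h <;> simp [h]
  have hle : |(2 * α - 1) * Real.sign y * heatKernel t (-|x|) (|y|)| ≤ heatKernel t x y := by
    rw [abs_mul, abs_mul, abs_of_nonneg (heatKernel_nonneg _ _ _)]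
    exact (mul_le_of_le_one_left (heatKernel_nonneg _ _ _)
      (mul_le_one₀ hc (abs_nonneg _) hsign)).trans (heatKernel_neg_abs_abs_le ht x y)
  rw [skewKernel_eq, two_mul (heatKernel t x y)]
  refine (abs_add_le _ _).trans (add_le_add ?_ hle)
  rw [abs_of_nonneg (heatKernel_nonneg _ _ _)]

theorem measurable_real_sign : Measurable Real.sign :=
  Measurable.ite measurableSet_Iio measurable_const
    (Measurable.ite measurableSet_Ioi measurable_const measurable_const)

theorem integrable_skewKernel_mul {α : ℝ} (hα : α ∈ Set.Icc (0 : ℝ) 1) {s t : ℝ} (hs : 0 < s)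
    (ht : 0 < t) (x y : ℝ) :
    Integrable fun z => skewKernel α s x z * skewKernel α t z y := by
  refine ((integrable_heatKernel_mul hs ht x y).const_mul 4).mono' ?_ (ae_of_all _ fun z => ?_)
  · have := measurable_real_sign
    unfold skewKernel heatKernel
    exact Measurable.aestronglyMeasurable (by fun_prop)
  · rw [Real.norm_eq_abs, abs_mul]
    calc |skewKernel α s x z| * |skewKernel α t z y|
        ≤ (2 * heatKernel s x z) * (2 * heatKernel t z y) :=
          mul_le_mul (abs_skewKernel_le hα hs x z) (abs_skewKernel_le hα ht z y) (abs_nonneg _)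
            (mul_nonneg zero_le_two (heatKernel_nonneg _ _ _))
      _ = 4 * (heatKernel s x z * heatKernel t z y) := by ring

/-- Up to an odd function of `z`, the product of two skew kernels is a combination of products of
heat kernels. -/
theorem skewKernel_mul_add_reflection (α s t x y z : ℝ) :
    skewKernel α s x z * skewKernel α t z y + skewKernel α s x (-z) * skewKernel α t (-z) y =
      (heatKernel s x z * heatKernel t z y +
        (2 * α - 1) * Real.sign y * (heatKernel s (-|x|) z * heatKernel t z |y|)) +
      (heatKernel s x (-z) * heatKernel t (-z) y +
        (2 * α - 1) * Real.sign y * (heatKernel s (-|x|) (-z) * heatKernel t (-z) |y|)) := by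
  have h₀ (u a : ℝ) : heatKernel u (-a) 0 = heatKernel u a 0 := by
    simpa using heatKernel_neg_neg u a 0
  simp only [skewKernel_eq, abs_neg, Real.sign_neg]
  rcases lt_trichotomy z 0 with hz | hz | hz <;> rcases lt_trichotomy y 0 with hy | hy | hy <;>
  rcases abs_choice x with hx | hx <;>
  simp only [abs_of_neg, abs_of_pos, hx, hy, hz, Real.sign_of_neg, Real.sign_of_pos,
    Real.sign_zero, abs_zero, neg_zero, neg_neg, heatKernel_neg_right, h₀] <;>
  ring

theorem integral_add_comp_neg {f : ℝ → ℝ} (hf : Integrable f) :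
    ∫ z, (f z + f (-z)) = 2 * ∫ z, f z := by
  rw [integral_add hf hf.comp_neg, integral_neg_eq_self f, two_mul]

theorem skewKernel_chapman_kolmogorov (α : ℝ) (hα : α ∈ Set.Icc (0 : ℝ) 1)
    (s t : ℝ) (hs : 0 < s) (ht : 0 < t) (x y : ℝ) :
    ∫ z, skewKernel α s x z * skewKernel α t z y = skewKernel α (s + t) x y := by
  have h₁ := integrable_heatKernel_mul hs ht x y
  have h₂ := (integrable_heatKernel_mul hs ht (-|x|) |y|).const_mul ((2 * α - 1) * Real.sign y)
  have h := integral_add_comp_neg (integrable_skewKernel_mul hα hs ht x y)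
  simp only [skewKernel_mul_add_reflection] at h
  have h' := integral_add_comp_neg (h₁.add h₂)
  simp only [Pi.add_apply] at h'
  rw [h', integral_add h₁ h₂, integral_const_mul, integral_heatKernel_mul hs ht,
    integral_heatKernel_mul hs ht, ← skewKernel_eq] at h
  linarith
end

section
/- (Aronson-type two-sided Gaussian bounds for the Skew Brownian motion kernel.) Let α ∈ [0,1]. Then for every t > 0 and all x, y ∈ ℝ, 2·min(α, 1−α)·p(t,x,y) ≤ q_α(t,x,y) ≤ 2·max(α, 1−α)·p(t,x,y). -/
open MeasureTheory Real Filter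

/-- The reflected Gaussian term is dominated by the heat kernel. -/
theorem reflected_le_heatKernel {t : ℝ} (ht : 0 < t) (x y : ℝ) :
    (Real.sqrt (2 * Real.pi * t))⁻¹ * Real.exp (-(|x| + |y|) ^ 2 / (2 * t)) ≤
      heatKernel t x y := by
  have h : (x - y) ^ 2 ≤ (|x| + |y|) ^ 2 := by
    rw [← sq_abs (x - y)]
    gcongr
    exact abs_sub x y
  unfold heatKernel
  gcongr

/-- The skew kernel differs from the heat kernel by at most `|2α-1|` times the heat kernel. -/
theorem abs_skewKernel_sub_heatKernel_le (α : ℝ) {t : ℝ} (ht : 0 < t) (x y : ℝ) :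
    |skewKernel α t x y - heatKernel t x y| ≤ |2 * α - 1| * heatKernel t x y := by
  have hs : |Real.sign y| ≤ 1 := by
    rcases Real.sign_apply_eq y with h | h | h <;> simp [h]
  have hB : 0 ≤ (Real.sqrt (2 * Real.pi * t))⁻¹ *
      Real.exp (-(|x| + |y|) ^ 2 / (2 * t)) := by positivity
  rw [skewKernel, add_sub_cancel_left, mul_assoc, abs_mul, abs_mul, abs_of_nonneg hB, mul_assoc]
  gcongr
  exact (mul_le_of_le_one_left hB hs).trans (reflected_le_heatKernel ht x y)

theorem skewKernel_aronson_bounds (α : ℝ) (hα : α ∈ Set.Icc (0 : ℝ) 1)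
    (t : ℝ) (ht : 0 < t) (x y : ℝ) :
    2 * min α (1 - α) * heatKernel t x y ≤ skewKernel α t x y ∧
      skewKernel α t x y ≤ 2 * max α (1 - α) * heatKernel t x y := by
  have h := abs_le.mp (abs_skewKernel_sub_heatKernel_le α ht x y)
  have hmin : 2 * min α (1 - α) = 1 - |2 * α - 1| := by grind
  have hmax : 2 * max α (1 - α) = 1 + |2 * α - 1| := by grind
  rw [hmin, hmax]
  constructor <;> linarith [h.1, h.2]
end

section
/- Let α ∈ [0,1] and let φ : ℝ → ℝ be bounded and continuous. Then the function u(t,x) = Q_t φ(x) is continuous on (0,∞) × ℝ, and at every point (t,x) with t > 0 and x ≠ 0 it is twice continuously differentiable in x, once continuously differentiable in t, and satisfies the heat equation ∂u/∂t (t,x) = (1/2)·∂²u/∂x² (t,x). -/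
open MeasureTheory Real Filter

/-- The Skew Brownian motion semigroup applied to a function:
`Q_t φ(x) = ∫ q_α(t,x,y) φ(y) dy`. -/
noncomputable def skewSemigroup (α t : ℝ) (φ : ℝ → ℝ) (x : ℝ) : ℝ :=
  ∫ y, skewKernel α t x y * φ y

/-- The unnormalised Gaussian moment `∫ (x-y)^j exp(-(x-y)²/(2t)) ψ(y) dy` of `ψ`. -/
noncomputable def gaussianMoment (ψ : ℝ → ℝ) (j : ℕ) (t x : ℝ) : ℝ :=
  ∫ y, (x - y) ^ j * Real.exp (-(x - y) ^ 2 / (2 * t)) * ψ y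

/-- The action of the heat semigroup on `ψ`. -/
noncomputable def heatSemigroup (ψ : ℝ → ℝ) (t x : ℝ) : ℝ :=
  ∫ y, heatKernel t x y * ψ y

/-- The function supported on the negative half-line whose heat evolution, evaluated at `|x|`,
is the skew part of the skew Brownian semigroup. -/
noncomputable def reflectedDifference (φ : ℝ → ℝ) : ℝ → ℝ :=
  (Set.Iic (0 : ℝ)).indicator fun y => φ (-y) - φ y

theorem abs_pow_mul_exp_neg_sq_le (j : ℕ) {t b x R : ℝ} (ht : 0 < t) (htb : t ≤ b)
    (hx : |x| ≤ R) (y : ℝ) :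
    |(x - y) ^ j * Real.exp (-(x - y) ^ 2 / (2 * t))| ≤
      j.factorial * Real.exp (b + R ^ 2 / (4 * b)) * Real.exp (-(1 / (8 * b)) * y ^ 2) := by
  have hb : 0 < b := ht.trans_le htb
  have h1 : |x - y| ^ j ≤ j.factorial * Real.exp |x - y| := by
    have := Real.pow_div_factorial_le_exp _ (abs_nonneg (x - y)) j
    rwa [div_le_iff₀' (by positivity)] at this
  have h2 : -(x - y) ^ 2 / (2 * t) ≤ -(x - y) ^ 2 / (2 * b) := by
    rw [neg_div, neg_div, neg_le_neg_iff]
    gcongr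
  have hxR : x ^ 2 ≤ R ^ 2 := by
    rw [← sq_abs x]
    gcongr
  have h3 : |x - y| + -(x - y) ^ 2 / (2 * b) ≤
      (b + R ^ 2 / (4 * b)) + -(1 / (8 * b)) * y ^ 2 := by
    have h4 : 0 ≤ (8 * b) * ((b + R ^ 2 / (4 * b)) + -(1 / (8 * b)) * y ^ 2
        - (|x - y| + -(x - y) ^ 2 / (2 * b))) := by
      have : (8 * b) * ((b + R ^ 2 / (4 * b)) + -(1 / (8 * b)) * y ^ 2
        - (|x - y| + -(x - y) ^ 2 / (2 * b)))
        = 8 * b ^ 2 + 2 * R ^ 2 - y ^ 2 - 8 * b * |x - y| + 4 * (x - y) ^ 2 := by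
        field_simp
        ring
      rw [this]
      nlinarith [sq_nonneg (2 * b - |x - y|), sq_abs (x - y), sq_nonneg (2 * x - y)]
    have := nonneg_of_mul_nonneg_right h4 (by positivity)
    linarith
  rw [abs_mul, abs_pow, Real.abs_exp]
  calc |x - y| ^ j * Real.exp (-(x - y) ^ 2 / (2 * t))
      ≤ (j.factorial * Real.exp |x - y|) * Real.exp (-(x - y) ^ 2 / (2 * b)) := by gcongr
    _ = j.factorial * Real.exp (|x - y| + -(x - y) ^ 2 / (2 * b)) := by
        rw [Real.exp_add]; ring
    _ ≤ j.factorial * Real.exp ((b + R ^ 2 / (4 * b)) + -(1 / (8 * b)) * y ^ 2) := by gcongr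
    _ = _ := by rw [Real.exp_add]; ring

theorem integrable_const_mul_exp_neg_mul_sq {b : ℝ} (hb : 0 < b) (C : ℝ) :
    Integrable fun y : ℝ => C * Real.exp (-(1 / (8 * b)) * y ^ 2) :=
  (integrable_exp_neg_mul_sq (by positivity)).const_mul C

section Moments

variable {ψ : ℝ → ℝ} {M : ℝ}

/-- A Gaussian dominating the integrands of the moments locally uniformly in `(t, x)`. -/
theorem abs_gaussianMoment_integrand_le (hψb : ∀ y, |ψ y| ≤ M) (j : ℕ) {t b x R : ℝ}
    (ht : 0 < t) (htb : t ≤ b) (hx : |x| ≤ R) (y : ℝ) :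
    |(x - y) ^ j * Real.exp (-(x - y) ^ 2 / (2 * t)) * ψ y| ≤
      (M * (j.factorial * Real.exp (b + R ^ 2 / (4 * b)))) *
        Real.exp (-(1 / (8 * b)) * y ^ 2) := by
  rw [abs_mul]
  calc _ ≤ (j.factorial * Real.exp (b + R ^ 2 / (4 * b)) * Real.exp (-(1 / (8 * b)) * y ^ 2)) * M :=
        mul_le_mul (abs_pow_mul_exp_neg_sq_le j ht htb hx y) (hψb y) (abs_nonneg _) (by positivity)
    _ = _ := by ring

theorem aestronglyMeasurable_gaussianMoment_integrand (hψm : Measurable ψ) (j : ℕ) (t x : ℝ) :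
    AEStronglyMeasurable
      (fun y => (x - y) ^ j * Real.exp (-(x - y) ^ 2 / (2 * t)) * ψ y) := by
  have : Measurable fun y => (x - y) ^ j * Real.exp (-(x - y) ^ 2 / (2 * t)) * ψ y := by
    fun_prop
  exact this.aestronglyMeasurable

theorem integrable_gaussianMoment_integrand (hψm : Measurable ψ) (hψb : ∀ y, |ψ y| ≤ M) (j : ℕ)
    {t : ℝ} (ht : 0 < t) (x : ℝ) :
    Integrable (fun y => (x - y) ^ j * Real.exp (-(x - y) ^ 2 / (2 * t)) * ψ y) :=
  (integrable_const_mul_exp_neg_mul_sq ht _).mono'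
    (aestronglyMeasurable_gaussianMoment_integrand hψm j t x)
    (ae_of_all _ (abs_gaussianMoment_integrand_le hψb j ht le_rfl le_rfl))

theorem continuousAt_gaussianMoment (hψm : Measurable ψ) (hψb : ∀ y, |ψ y| ≤ M) (j : ℕ)
    {t : ℝ} (ht : 0 < t) (x : ℝ) :
    ContinuousAt (fun p : ℝ × ℝ => gaussianMoment ψ j p.1 p.2) (t, x) := by
  have hnhds : ∀ᶠ p : ℝ × ℝ in nhds (t, x), (0 < p.1 ∧ p.1 < 2 * t) ∧ |p.2| < |x| + 1 :=
    ((continuousAt_const.eventually_lt continuousAt_fst ht).and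
      (continuousAt_fst.eventually_lt continuousAt_const (by dsimp only; linarith))).and
      (continuousAt_snd.abs.eventually_lt continuousAt_const (by dsimp only; linarith))
  refine continuousAt_of_dominated
    (.of_forall fun p => aestronglyMeasurable_gaussianMoment_integrand hψm j p.1 p.2)
    (hnhds.mono fun p hp => ae_of_all _ fun y =>
      abs_gaussianMoment_integrand_le hψb j hp.1.1 hp.1.2.le hp.2.le y)
    (integrable_const_mul_exp_neg_mul_sq (by positivity) _)
    (ae_of_all _ fun y => ?_)
  have : 2 * t ≠ 0 := by positivity
  fun_prop (disch := exact this)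

theorem hasDerivAt_gaussianMoment_space (hψm : Measurable ψ) (hψb : ∀ y, |ψ y| ≤ M) (j : ℕ)
    {t : ℝ} (ht : 0 < t) (x : ℝ) :
    HasDerivAt (gaussianMoment ψ j t)
      (j * gaussianMoment ψ (j - 1) t x - t⁻¹ * gaussianMoment ψ (j + 1) t x) x := by
  have hs : Metric.ball x 1 ∈ nhds x := Metric.ball_mem_nhds x one_pos
  have hR : ∀ z ∈ Metric.ball x 1, |z| ≤ |x| + 1 := fun z hz => by
    have := abs_sub_abs_le_abs_sub z x
    rw [Metric.mem_ball, Real.dist_eq] at hz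
    linarith
  have hI := fun k => integrable_gaussianMoment_integrand hψm hψb k ht x
  have key := hasDerivAt_integral_of_dominated_loc_of_deriv_le (μ := volume) (x₀ := x)
    (F := fun z y => (z - y) ^ j * Real.exp (-(z - y) ^ 2 / (2 * t)) * ψ y)
    (F' := fun z y => j * ((z - y) ^ (j - 1) * Real.exp (-(z - y) ^ 2 / (2 * t)) * ψ y)
      - t⁻¹ * ((z - y) ^ (j + 1) * Real.exp (-(z - y) ^ 2 / (2 * t)) * ψ y))
    (bound := fun y => j * ((M * ((j - 1).factorial * Real.exp (t + (|x| + 1) ^ 2 / (4 * t)))) *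
        Real.exp (-(1 / (8 * t)) * y ^ 2)) +
      t⁻¹ * ((M * ((j + 1).factorial * Real.exp (t + (|x| + 1) ^ 2 / (4 * t)))) *
        Real.exp (-(1 / (8 * t)) * y ^ 2)))
    hs
    (.of_forall fun z => aestronglyMeasurable_gaussianMoment_integrand hψm j t z)
    (hI j)
    (((hI _).const_mul _).sub ((hI _).const_mul _)).aestronglyMeasurable
    (ae_of_all _ fun y z hz => by
      rw [Real.norm_eq_abs]
      refine (abs_sub _ _).trans ?_
      rw [abs_mul (j : ℝ), abs_mul t⁻¹, Nat.abs_cast, abs_of_pos (inv_pos.2 ht)]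
      exact add_le_add
        (mul_le_mul_of_nonneg_left
          (abs_gaussianMoment_integrand_le hψb _ ht le_rfl (hR z hz) y) (by positivity))
        (mul_le_mul_of_nonneg_left
          (abs_gaussianMoment_integrand_le hψb _ ht le_rfl (hR z hz) y) (by positivity)))
    (((integrable_const_mul_exp_neg_mul_sq ht _).const_mul _).add
      ((integrable_const_mul_exp_neg_mul_sq ht _).const_mul _))
    (ae_of_all _ fun y z _ => by
      have h1 : HasDerivAt (fun z => z - y) 1 z := (hasDerivAt_id z).sub_const y
      convert! (((h1.pow j).mul ((h1.pow 2).neg.div_const (2 * t)).exp).mul_const (ψ y)) using 1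
      simp only [Pi.pow_apply, Pi.neg_apply]
      field_simp
      push_cast
      ring)
  have h := key.2
  rw [integral_sub ((hI _).const_mul _) ((hI _).const_mul _), integral_const_mul,
    integral_const_mul] at h
  exact h

theorem hasDerivAt_gaussianMoment_time (hψm : Measurable ψ) (hψb : ∀ y, |ψ y| ≤ M) (j : ℕ)
    {t : ℝ} (ht : 0 < t) (x : ℝ) :
    HasDerivAt (fun s => gaussianMoment ψ j s x)
      (1 / (2 * t ^ 2) * gaussianMoment ψ (j + 2) t x) t := by
  have hs : Set.Ioo (t / 2) (2 * t) ∈ nhds t := Ioo_mem_nhds (by linarith) (by linarith)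
  have hI := fun k => integrable_gaussianMoment_integrand hψm hψb k ht x
  have key := hasDerivAt_integral_of_dominated_loc_of_deriv_le (μ := volume) (x₀ := t)
    (F := fun s y => (x - y) ^ j * Real.exp (-(x - y) ^ 2 / (2 * s)) * ψ y)
    (F' := fun s y => 1 / (2 * s ^ 2) *
      ((x - y) ^ (j + 2) * Real.exp (-(x - y) ^ 2 / (2 * s)) * ψ y))
    (bound := fun y => 1 / (2 * (t / 2) ^ 2) *
      ((M * ((j + 2).factorial * Real.exp (2 * t + |x| ^ 2 / (4 * (2 * t))))) *
        Real.exp (-(1 / (8 * (2 * t))) * y ^ 2)))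
    hs
    (.of_forall fun s => aestronglyMeasurable_gaussianMoment_integrand hψm j s x)
    (hI j)
    ((hI _).const_mul _).aestronglyMeasurable
    (ae_of_all _ fun y s hs => by
      have hs0 : 0 < s := (half_pos ht).trans hs.1
      rw [Real.norm_eq_abs, abs_mul, abs_of_pos (a := 1 / (2 * s ^ 2)) (by positivity)]
      refine mul_le_mul ?_ (abs_gaussianMoment_integrand_le hψb _ hs0 hs.2.le le_rfl y)
        (abs_nonneg _) (by positivity)
      have := hs.1.le
      gcongr)
    ((integrable_const_mul_exp_neg_mul_sq (by positivity) _).const_mul _)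
    (ae_of_all _ fun y s hs => by
      have hs0 : 0 < s := (half_pos ht).trans hs.1
      have h1 : HasDerivAt (fun s : ℝ => 2 * s) (2 * 1) s := (hasDerivAt_id s).const_mul 2
      convert! ((((hasDerivAt_const s (-(x - y) ^ 2)).div h1 (by positivity)).exp.const_mul
        ((x - y) ^ j)).mul_const (ψ y)) using 1
      simp only [Pi.div_apply]
      field_simp
      ring)
  have h := key.2
  rw [integral_const_mul] at h
  exact h

theorem heatSemigroup_eq (ψ : ℝ → ℝ) (t x : ℝ) :
    heatSemigroup ψ t x = (Real.sqrt (2 * Real.pi * t))⁻¹ * gaussianMoment ψ 0 t x := by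
  simp only [heatSemigroup, gaussianMoment, heatKernel, pow_zero, one_mul, mul_assoc,
    integral_const_mul]

theorem continuousAt_heatSemigroup (hψm : Measurable ψ) (hψb : ∀ y, |ψ y| ≤ M)
    {t : ℝ} (ht : 0 < t) (x : ℝ) :
    ContinuousAt (fun p : ℝ × ℝ => heatSemigroup ψ p.1 p.2) (t, x) := by
  simp only [heatSemigroup_eq]
  refine ContinuousAt.mul ?_ (continuousAt_gaussianMoment hψm hψb 0 ht x)
  have : Real.sqrt (2 * Real.pi * t) ≠ 0 := by positivity
  fun_prop (disch := exact this)

/-- The second space derivative of the heat evolution of `ψ`, in terms of Gaussian moments. -/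
noncomputable def heatLaplacian (ψ : ℝ → ℝ) (t x : ℝ) : ℝ :=
  (Real.sqrt (2 * Real.pi * t))⁻¹ *
    (t⁻¹ ^ 2 * gaussianMoment ψ 2 t x - t⁻¹ * gaussianMoment ψ 0 t x)

theorem continuousAt_heatLaplacian (hψm : Measurable ψ) (hψb : ∀ y, |ψ y| ≤ M)
    {t : ℝ} (ht : 0 < t) (x : ℝ) :
    ContinuousAt (fun p : ℝ × ℝ => heatLaplacian ψ p.1 p.2) (t, x) := by
  have h0 := continuousAt_gaussianMoment hψm hψb 0 ht x
  have h2 := continuousAt_gaussianMoment hψm hψb 2 ht x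
  have ha : Real.sqrt (2 * Real.pi * t) ≠ 0 := by positivity
  have hi : ContinuousAt (fun p : ℝ × ℝ => p.1⁻¹) (t, x) := continuousAt_fst.inv₀ ht.ne'
  have hc : ContinuousAt (fun p : ℝ × ℝ => (Real.sqrt (2 * Real.pi * p.1))⁻¹) (t, x) := by
    fun_prop (disch := exact ha)
  exact hc.mul (((hi.pow 2).mul h2).sub (hi.mul h0))

theorem hasDerivAt_heatSemigroup_time (hψm : Measurable ψ) (hψb : ∀ y, |ψ y| ≤ M)
    {t : ℝ} (ht : 0 < t) (x : ℝ) :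
    HasDerivAt (fun s => heatSemigroup ψ s x) (1 / 2 * heatLaplacian ψ t x) t := by
  simp only [heatSemigroup_eq]
  have h1 : HasDerivAt (fun s : ℝ => 2 * Real.pi * s) (2 * Real.pi * 1) t :=
    (hasDerivAt_id t).const_mul _
  have hpos : 0 < 2 * Real.pi * t := by positivity
  have hsq : Real.sqrt (2 * Real.pi * t) ≠ 0 := by positivity
  convert! ((h1.sqrt hpos.ne').inv hsq).mul (hasDerivAt_gaussianMoment_time hψm hψb 0 ht x) using 1
  simp only [heatLaplacian, Pi.inv_apply]
  have hinv : -(2 * Real.pi * 1 / (2 * Real.sqrt (2 * Real.pi * t)))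
      / Real.sqrt (2 * Real.pi * t) ^ 2 = -(Real.sqrt (2 * Real.pi * t))⁻¹ * (1 / (2 * t)) := by
    rw [Real.sq_sqrt hpos.le]
    field_simp
  rw [hinv]
  field_simp
  ring

theorem hasDerivAt_heatSemigroup_space (hψm : Measurable ψ) (hψb : ∀ y, |ψ y| ≤ M)
    {t : ℝ} (ht : 0 < t) (x : ℝ) :
    HasDerivAt (heatSemigroup ψ t)
      ((Real.sqrt (2 * Real.pi * t))⁻¹ * (-t⁻¹ * gaussianMoment ψ 1 t x)) x := by
  have h := (hasDerivAt_gaussianMoment_space hψm hψb 0 ht x).const_mul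
    (Real.sqrt (2 * Real.pi * t))⁻¹
  rw [show heatSemigroup ψ t = _ from funext (heatSemigroup_eq ψ t)]
  convert! h using 1
  simp

theorem deriv_heatSemigroup (hψm : Measurable ψ) (hψb : ∀ y, |ψ y| ≤ M) {t : ℝ} (ht : 0 < t) :
    deriv (heatSemigroup ψ t) = fun x =>
      (Real.sqrt (2 * Real.pi * t))⁻¹ * (-t⁻¹ * gaussianMoment ψ 1 t x) :=
  funext fun x => (hasDerivAt_heatSemigroup_space hψm hψb ht x).deriv

theorem hasDerivAt_deriv_heatSemigroup (hψm : Measurable ψ) (hψb : ∀ y, |ψ y| ≤ M)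
    {t : ℝ} (ht : 0 < t) (x : ℝ) :
    HasDerivAt (deriv (heatSemigroup ψ t)) (heatLaplacian ψ t x) x := by
  rw [deriv_heatSemigroup hψm hψb ht]
  convert! ((hasDerivAt_gaussianMoment_space hψm hψb 1 ht x).const_mul (-t⁻¹)).const_mul
    (Real.sqrt (2 * Real.pi * t))⁻¹ using 1
  simp only [heatLaplacian, Nat.cast_one, Nat.sub_self, Nat.reduceAdd]
  ring

theorem deriv_deriv_heatSemigroup (hψm : Measurable ψ) (hψb : ∀ y, |ψ y| ≤ M)
    {t : ℝ} (ht : 0 < t) : deriv (deriv (heatSemigroup ψ t)) = heatLaplacian ψ t :=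
  funext fun x => (hasDerivAt_deriv_heatSemigroup hψm hψb ht x).deriv

theorem contDiff_heatSemigroup (hψm : Measurable ψ) (hψb : ∀ y, |ψ y| ≤ M)
    {t : ℝ} (ht : 0 < t) : ContDiff ℝ 2 (heatSemigroup ψ t) := by
  rw [show (2 : WithTop ℕ∞) = 1 + 1 from one_add_one_eq_two.symm, contDiff_succ_iff_deriv]
  refine ⟨fun x => (hasDerivAt_heatSemigroup_space hψm hψb ht x).differentiableAt, by simp, ?_⟩
  rw [contDiff_one_iff_deriv]
  refine ⟨fun x => (hasDerivAt_deriv_heatSemigroup hψm hψb ht x).differentiableAt, ?_⟩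
  rw [deriv_deriv_heatSemigroup hψm hψb ht, continuous_iff_continuousAt]
  intro x
  exact (continuousAt_heatLaplacian hψm hψb ht x).comp₂ continuousAt_const continuousAt_id

theorem iteratedDeriv_two_heatSemigroup (hψm : Measurable ψ) (hψb : ∀ y, |ψ y| ≤ M)
    {t : ℝ} (ht : 0 < t) : iteratedDeriv 2 (heatSemigroup ψ t) = heatLaplacian ψ t := by
  rw [iteratedDeriv_succ, iteratedDeriv_one, deriv_deriv_heatSemigroup hψm hψb ht]

theorem contDiffAt_heatSemigroup_time (hψm : Measurable ψ) (hψb : ∀ y, |ψ y| ≤ M)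
    {t : ℝ} (ht : 0 < t) (x : ℝ) : ContDiffAt ℝ 1 (fun s => heatSemigroup ψ s x) t := by
  rw [contDiffAt_one_iff]
  refine ⟨fun s => ContinuousLinearMap.toSpanSingleton ℝ (1 / 2 * heatLaplacian ψ s x),
    Set.Ioi 0, Ioi_mem_nhds ht, fun s hs => ContinuousAt.continuousWithinAt ?_,
    fun s hs => (hasDerivAt_heatSemigroup_time hψm hψb hs x).hasFDerivAt⟩
  have h : ContinuousAt (fun s => 1 / 2 * heatLaplacian ψ s x) s :=
    ((continuousAt_heatLaplacian hψm hψb hs x).comp₂ continuousAt_id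
      continuousAt_const).const_mul _
  exact (ContinuousLinearMap.toSpanSingletonCLE (𝕜 := ℝ) (E := ℝ)).continuous.continuousAt.comp h

theorem contDiffAt_heatSemigroup_abs (hψm : Measurable ψ) (hψb : ∀ y, |ψ y| ≤ M)
    {t : ℝ} (ht : 0 < t) {x : ℝ} (hx : x ≠ 0) :
    ContDiffAt ℝ 2 (fun x' => heatSemigroup ψ t |x'|) x :=
  (contDiff_heatSemigroup hψm hψb ht).contDiffAt.comp x (contDiffAt_abs hx)

end Moments

theorem iteratedDeriv_two_comp_abs (f : ℝ → ℝ) {x : ℝ} (hx : x ≠ 0) :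
    iteratedDeriv 2 (fun x' => f |x'|) x = iteratedDeriv 2 f |x| := by
  rcases hx.lt_or_gt with h | h
  · have heq : (fun x' => f |x'|) =ᶠ[nhds x] fun x' => f (-x') :=
      mem_of_superset (Iio_mem_nhds h) fun x' hx' => by simp [abs_of_neg (Set.mem_Iio.1 hx')]
    rw [heq.iteratedDeriv_eq, iteratedDeriv_comp_neg, abs_of_neg h]
    simp
  · have heq : (fun x' => f |x'|) =ᶠ[nhds x] f :=
      mem_of_superset (Ioi_mem_nhds h) fun x' hx' => by simp [abs_of_pos (Set.mem_Ioi.1 hx')]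
    rw [heq.iteratedDeriv_eq, abs_of_pos h]

theorem measurable_reflectedDifference {φ : ℝ → ℝ} (hφ : Measurable φ) :
    Measurable (reflectedDifference φ) :=
  ((hφ.comp measurable_neg).sub hφ).indicator measurableSet_Iic

theorem abs_reflectedDifference_le {φ : ℝ → ℝ} {M : ℝ} (hφ : ∀ y, |φ y| ≤ M) (y : ℝ) :
    |reflectedDifference φ y| ≤ M + M := by
  have hM : 0 ≤ M := (abs_nonneg _).trans (hφ 0)
  unfold reflectedDifference
  by_cases hy : y ∈ Set.Iic (0 : ℝ)
  · rw [Set.indicator_of_mem hy]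
    exact (abs_sub _ _).trans (add_le_add (hφ _) (hφ _))
  · rw [Set.indicator_of_notMem hy, abs_zero]
    positivity

theorem abs_real_sign_le_one (y : ℝ) : |Real.sign y| ≤ 1 := by
  rcases Real.sign_apply_eq y with h | h | h <;> rw [h] <;> simp

theorem integrable_sign_mul_exp {φ : ℝ → ℝ} {M : ℝ} (hφm : Measurable φ) (hφb : ∀ y, |φ y| ≤ M)
    {t : ℝ} (ht : 0 < t) (x : ℝ) :
    Integrable fun y => Real.sign y * Real.exp (-(|x| + |y|) ^ 2 / (2 * t)) * φ y := by
  have hm : Measurable fun y =>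
      Real.sign y * Real.exp (-(|x| + |y|) ^ 2 / (2 * t)) * φ y := by
    have := measurable_real_sign
    fun_prop
  refine ((integrable_exp_neg_mul_sq (b := 1 / (2 * t)) (by positivity)).mul_const M).mono'
    hm.aestronglyMeasurable (ae_of_all _ fun y => ?_)
  rw [Real.norm_eq_abs, abs_mul, abs_mul, Real.abs_exp]
  refine mul_le_mul ?_ (hφb y) (abs_nonneg _) (by positivity)
  calc |Real.sign y| * Real.exp (-(|x| + |y|) ^ 2 / (2 * t))
      ≤ 1 * Real.exp (-(1 / (2 * t)) * y ^ 2) := by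
        refine mul_le_mul (abs_real_sign_le_one y) (Real.exp_le_exp.2 ?_) (by positivity) one_pos.le
        rw [neg_div, neg_mul, neg_le_neg_iff, one_div, ← div_eq_inv_mul, ← sq_abs y]
        gcongr
        linarith [abs_nonneg x]
    _ = _ := one_mul _

theorem integral_sign_mul_exp {φ : ℝ → ℝ} {M : ℝ} (hφm : Measurable φ) (hφb : ∀ y, |φ y| ≤ M)
    {t : ℝ} (ht : 0 < t) (x : ℝ) :
    ∫ y, Real.sign y * Real.exp (-(|x| + |y|) ^ 2 / (2 * t)) * φ y =
      gaussianMoment (reflectedDifference φ) 0 t |x| := by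
  have hI := integrable_sign_mul_exp hφm hφb ht x
  have hneg := integral_comp_neg_Iic 0
    fun y => Real.sign y * Real.exp (-(|x| + |y|) ^ 2 / (2 * t)) * φ y
  rw [neg_zero] at hneg
  rw [← intervalIntegral.integral_Iic_add_Ioi (b := 0) hI.integrableOn hI.integrableOn, ← hneg,
    ← integral_add hI.integrableOn hI.comp_neg.integrableOn, gaussianMoment,
    ← integral_indicator measurableSet_Iic]
  congr 1 with y
  unfold reflectedDifference
  by_cases hy : y ∈ Set.Iic (0 : ℝ)
  · rw [Set.indicator_of_mem hy, Set.indicator_of_mem hy]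
    rcases (Set.mem_Iic.1 hy).lt_or_eq with h | rfl
    · rw [Real.sign_of_neg h, Real.sign_of_pos (neg_pos.2 h), abs_neg, abs_of_neg h,
        ← sub_eq_add_neg]
      ring
    · simp
  · rw [Set.indicator_of_notMem hy, Set.indicator_of_notMem hy, mul_zero]

theorem skewSemigroup_eq {φ : ℝ → ℝ} {M : ℝ} (hφm : Measurable φ) (hφb : ∀ y, |φ y| ≤ M)
    (α : ℝ) {t : ℝ} (ht : 0 < t) (x : ℝ) :
    skewSemigroup α t φ x =
      heatSemigroup φ t x + (2 * α - 1) * heatSemigroup (reflectedDifference φ) t |x| := by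
  have h1 : Integrable fun y => heatKernel t x y * φ y := by
    have := (integrable_gaussianMoment_integrand hφm hφb 0 ht x).const_mul
      (Real.sqrt (2 * Real.pi * t))⁻¹
    simpa only [heatKernel, pow_zero, one_mul, mul_assoc] using this
  have h2 := (integrable_sign_mul_exp hφm hφb ht x).const_mul
    ((2 * α - 1) * (Real.sqrt (2 * Real.pi * t))⁻¹)
  rw [heatSemigroup_eq (reflectedDifference φ), ← integral_sign_mul_exp hφm hφb ht, ← mul_assoc,
    ← integral_const_mul, heatSemigroup, ← integral_add h1 h2, skewSemigroup]
  congr 1 with y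
  rw [skewKernel]
  ring

theorem skewSemigroup_solves_heat_equation (α : ℝ) (hα : α ∈ Set.Icc (0 : ℝ) 1)
    (φ : ℝ → ℝ) (hφc : Continuous φ) (hφb : ∃ M, ∀ x, |φ x| ≤ M) :
    ContinuousOn (fun p : ℝ × ℝ => skewSemigroup α p.1 φ p.2)
        (Set.Ioi (0 : ℝ) ×ˢ (Set.univ : Set ℝ)) ∧
      ∀ t > (0 : ℝ), ∀ x : ℝ, x ≠ 0 →
        ContDiffAt ℝ 2 (fun x' => skewSemigroup α t φ x') x ∧
        ContDiffAt ℝ 1 (fun s => skewSemigroup α s φ x) t ∧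
        deriv (fun s => skewSemigroup α s φ x) t
          = (1 / 2) * iteratedDeriv 2 (fun x' => skewSemigroup α t φ x') x := by
  obtain ⟨M, hφb⟩ := hφb
  have hφm := hφc.measurable
  have hψm := measurable_reflectedDifference hφm
  have hψb := abs_reflectedDifference_le hφb
  have heq := fun {t : ℝ} (ht : 0 < t) x => skewSemigroup_eq hφm hφb α ht x
  refine ⟨?_, fun t ht x hx => ?_⟩
  · refine ContinuousOn.congr (fun p hp => ContinuousAt.continuousWithinAt ?_)
      fun p hp => heq hp.1 p.2
    have habs : ContinuousAt (fun q : ℝ × ℝ => heatSemigroup (reflectedDifference φ) q.1 |q.2|) p :=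
      (continuousAt_heatSemigroup hψm hψb hp.1 |p.2|).comp₂ continuousAt_fst continuousAt_snd.abs
    exact (continuousAt_heatSemigroup hφm hφb hp.1 p.2).add (habs.const_mul _)
  · have hspace : (fun x' => skewSemigroup α t φ x') = fun x' =>
        heatSemigroup φ t x' + (2 * α - 1) * heatSemigroup (reflectedDifference φ) t |x'| :=
      funext (heq ht)
    have htime : (fun s => skewSemigroup α s φ x) =ᶠ[nhds t] fun s =>
        heatSemigroup φ s x + (2 * α - 1) * heatSemigroup (reflectedDifference φ) s |x| :=
      mem_of_superset (Ioi_mem_nhds ht) fun s hs => heq hs x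
    have hc1 := (contDiff_heatSemigroup hφm hφb ht).contDiffAt (x := x)
    have hc2 := contDiffAt_heatSemigroup_abs hψm hψb ht hx
    have hc3 : ContDiffAt ℝ 2 (fun x' =>
        (2 * α - 1) * heatSemigroup (reflectedDifference φ) t |x'|) x := contDiffAt_const.mul hc2
    refine ⟨hspace ▸ hc1.add hc3, ?_, ?_⟩
    · exact ((contDiffAt_heatSemigroup_time hφm hφb ht x).add (contDiffAt_const.mul
        (contDiffAt_heatSemigroup_time hψm hψb ht |x|))).congr_of_eventuallyEq htime
    · rw [htime.deriv_eq, ((hasDerivAt_heatSemigroup_time hφm hφb ht x).fun_add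
        ((hasDerivAt_heatSemigroup_time hψm hψb ht |x|).const_mul (2 * α - 1))).deriv, hspace,
        iteratedDeriv_fun_add hc1 hc3, iteratedDeriv_const_mul_field,
        iteratedDeriv_two_comp_abs _ hx, iteratedDeriv_two_heatSemigroup hφm hφb ht,
        iteratedDeriv_two_heatSemigroup hψm hψb ht]
      ring
end

section
/- (Maximum principle for the transmission problem.) Let α ∈ [0,1], let C ∈ ℝ, and let φ : ℝ → ℝ be bounded and continuous with φ(x) ≤ C for all x. Suppose u : [0,∞) × ℝ → ℝ is bounded, continuous on [0,∞) × ℝ, satisfies u(0,x) = φ(x) for all x, is of class C^{1,2} on (0,∞) × (ℝ \ {0}) where it satisfies ∂u/∂t = (1/2)·∂²u/∂x², and for every t > 0 the one-sided spatial derivatives ∂_x u(t,0+) and ∂_x u(t,0−) exist and satisfy α·∂_x u(t,0+) = (1−α)·∂_x u(t,0−). Then u(t,x) ≤ C for all (t,x) ∈ [0,∞) × ℝ. -/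
open MeasureTheory Real Filter

/-- `u` is a (bounded-data) solution of the transmission problem of parameter `α`
with initial condition `φ`: it is continuous on `[0,∞) × ℝ`, equals `φ` at `t = 0`,
is `C²` in `x` and `C¹` in `t` at every point of `(0,∞) × (ℝ \ {0})` where it satisfies
the heat equation `∂u/∂t = (1/2)·∂²u/∂x²`, and for every `t > 0` the one-sided spatial
derivatives at `0` exist and satisfy the flux condition `α·∂ₓu(t,0+) = (1-α)·∂ₓu(t,0-)`. -/
def IsTransmissionSolution (α : ℝ) (φ : ℝ → ℝ) (u : ℝ → ℝ → ℝ) : Prop :=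
  (∀ x, u 0 x = φ x) ∧
  ContinuousOn (fun p : ℝ × ℝ => u p.1 p.2) (Set.Ici (0 : ℝ) ×ˢ (Set.univ : Set ℝ)) ∧
  (∀ t > (0 : ℝ), ∀ x : ℝ, x ≠ 0 →
    ContDiffAt ℝ 2 (fun x' => u t x') x ∧
    ContDiffAt ℝ 1 (fun s => u s x) t ∧
    deriv (fun s => u s x) t = (1 / 2) * iteratedDeriv 2 (fun x' => u t x') x) ∧
  (∀ t > (0 : ℝ), ∃ dp dm : ℝ,
    Filter.Tendsto (fun h => (u t h - u t 0) / h) (nhdsWithin 0 (Set.Ioi 0)) (nhds dp) ∧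
    Filter.Tendsto (fun h => (u t h - u t 0) / h) (nhdsWithin 0 (Set.Iio 0)) (nhds dm) ∧
    α * dp = (1 - α) * dm)

/-- The second derivative at a global maximum is nonpositive. -/
theorem deriv_deriv_nonpos_of_forall_le {f : ℝ → ℝ} {x₀ : ℝ} (hc : ContinuousAt f x₀)
    (h : ∀ x, f x ≤ f x₀) : deriv (deriv f) x₀ ≤ 0 := by
  by_contra! hpos
  have hmax : IsLocalMax f x₀ := Eventually.of_forall h
  have hmin := isLocalMin_of_deriv_deriv_pos hpos hmax.deriv_eq_zero hc
  have hconst : f =ᶠ[nhds x₀] fun _ => f x₀ := by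
    filter_upwards [hmin] with x hx
    exact le_antisymm (h x) hx
  have hzero : deriv (deriv f) x₀ = 0 := by
    rw [hconst.deriv.deriv_eq]
    simp
  exact hpos.ne' hzero

/-- The derivative at a maximum over a left neighbourhood is nonnegative. -/
theorem HasDerivAt.nonneg_of_eventually_le_left {f : ℝ → ℝ} {f' t : ℝ} (hf : HasDerivAt f f' t)
    (h : ∀ᶠ s in nhdsWithin t (Set.Iio t), f s ≤ f t) : 0 ≤ f' := by
  have hs := (hasDerivWithinAt_iff_tendsto_slope' (s := Set.Iio t) (by simp)).1
    hf.hasDerivWithinAt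
  refine ge_of_tendsto hs ?_
  filter_upwards [h, self_mem_nhdsWithin] with s hs hst
  rw [slope_def_field]
  exact div_nonneg_of_nonpos (by linarith) (by linarith [Set.mem_Iio.1 hst])

/-- At an interior point, a function touched from above by `ε (2 t + x² - |x|)` up to a constant
cannot solve the heat equation. -/
theorem false_of_heat_of_touching {u : ℝ → ℝ → ℝ} {ε t y : ℝ} (hε : 0 < ε) (ht : 0 < t)
    (hx : ContDiffAt ℝ 2 (fun x => u t x) y) (hs : ContDiffAt ℝ 1 (fun s => u s y) t)
    (heat : deriv (fun s => u s y) t = (1 / 2) * iteratedDeriv 2 (fun x => u t x) y)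
    (hspace : ∀ x, u t x - ε * (x ^ 2 - |x|) ≤ u t y - ε * (y ^ 2 - |y|))
    (htime : ∀ s ∈ Set.Icc 0 t, u s y - ε * (2 * s) ≤ u t y - ε * (2 * t)) : False := by
  have h1 : 0 ≤ deriv (fun s => u s y) t - ε * (2 * 1) := by
    have hd : HasDerivAt (fun s => u s y - ε * (2 * s))
        (deriv (fun s => u s y) t - ε * (2 * 1)) t :=
      (hs.differentiableAt (by norm_num)).hasDerivAt.sub
        (((hasDerivAt_id t).const_mul 2).const_mul ε)
    refine hd.nonneg_of_eventually_le_left ?_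
    filter_upwards [Ioo_mem_nhdsLT ht] with s hs
    exact htime s ⟨hs.1.le, hs.2.le⟩
  obtain ⟨c, hc, hcy⟩ : ∃ c : ℝ, (∀ x, c * x ≤ |x|) ∧ c * y = |y| := by
    rcases le_total 0 y with h | h
    · exact ⟨1, fun x => by simpa using le_abs_self x, by simp [abs_of_nonneg h]⟩
    · exact ⟨-1, fun x => by simpa using neg_le_abs x, by simp [abs_of_nonpos h]⟩
  have hp : ContDiff ℝ 2 (fun x : ℝ => ε * (x ^ 2 - c * x)) := by fun_prop
  have h2 := deriv_deriv_nonpos_of_forall_le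
    (f := (fun x => u t x) - fun x => ε * (x ^ 2 - c * x))
    (hx.continuousAt.sub hp.continuous.continuousAt) (x₀ := y) (fun x => by
      simp only [Pi.sub_apply]
      have := hspace x
      nlinarith [mul_le_mul_of_nonneg_left (hc x) hε.le])
  have hp' : deriv (fun x : ℝ => ε * (x ^ 2 - c * x)) = fun x => ε * (2 * x - c) := by
    ext x
    have : HasDerivAt (fun x : ℝ => ε * (x ^ 2 - c * x)) (ε * (2 * x - c)) x :=
      (((hasDerivAt_pow 2 x).sub ((hasDerivAt_id x).const_mul c)).const_mul ε).congr_deriv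
        (by simp)
    exact this.deriv
  have hp'' : iteratedDeriv 2 (fun x : ℝ => ε * (x ^ 2 - c * x)) y = ε * 2 := by
    rw [iteratedDeriv_succ, iteratedDeriv_one, hp']
    have : HasDerivAt (fun x : ℝ => ε * (2 * x - c)) (ε * 2) y :=
      ((((hasDerivAt_id y).const_mul 2).sub_const c).const_mul ε).congr_deriv (by simp)
    exact this.deriv
  have h3 : iteratedDeriv 2 ((fun x => u t x) - fun x => ε * (x ^ 2 - c * x)) y
      = iteratedDeriv 2 (fun x => u t x) y - ε * 2 := by
    rw [iteratedDeriv_sub hx hp.contDiffAt, hp'']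
  rw [iteratedDeriv_succ, iteratedDeriv_one] at h3
  linarith

/-- A function touched from above at `0` by `ε (x² - |x|)` up to a constant cannot satisfy the
flux condition. -/
theorem false_of_flux_of_touching {α ε dp dm : ℝ} (hα : α ∈ Set.Icc (0 : ℝ) 1) {f : ℝ → ℝ}
    (hε : 0 < ε)
    (hp : Tendsto (fun h => (f h - f 0) / h) (nhdsWithin 0 (Set.Ioi 0)) (nhds dp))
    (hm : Tendsto (fun h => (f h - f 0) / h) (nhdsWithin 0 (Set.Iio 0)) (nhds dm))
    (flux : α * dp = (1 - α) * dm) (hmax : ∀ x, f x - ε * (x ^ 2 - |x|) ≤ f 0) : False := by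
  have h1 : dp ≤ -ε := by
    have hl : Tendsto (fun h : ℝ => ε * (h - 1)) (nhdsWithin 0 (Set.Ioi 0)) (nhds (-ε)) := by
      have : ContinuousAt (fun h : ℝ => ε * (h - 1)) 0 := by fun_prop
      simpa using this.tendsto.mono_left nhdsWithin_le_nhds
    refine le_of_tendsto_of_tendsto hp hl ?_
    filter_upwards [self_mem_nhdsWithin] with h hh
    have hh : 0 < h := hh
    have := hmax h
    rw [abs_of_pos hh] at this
    rw [div_le_iff₀ hh]
    nlinarith
  have h2 : ε ≤ dm := by
    have hl : Tendsto (fun h : ℝ => ε * (h + 1)) (nhdsWithin 0 (Set.Iio 0)) (nhds ε) := by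
      have : ContinuousAt (fun h : ℝ => ε * (h + 1)) 0 := by fun_prop
      simpa using this.tendsto.mono_left nhdsWithin_le_nhds
    refine le_of_tendsto_of_tendsto hl hm ?_
    filter_upwards [self_mem_nhdsWithin] with h hh
    have hh : h < 0 := hh
    have := hmax h
    rw [abs_of_neg hh] at this
    rw [le_div_iff_of_neg hh]
    nlinarith
  nlinarith [mul_le_mul_of_nonneg_left h1 hα.1,
    mul_le_mul_of_nonneg_left h2 (sub_nonneg.2 hα.2)]

/-- A bounded solution with initial data at most `C` lies below the barrier
`C + ε (1 + 2 t + x² - |x|)`. -/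
theorem IsTransmissionSolution.le_barrier {α C M ε : ℝ} {φ : ℝ → ℝ} {u : ℝ → ℝ → ℝ}
    (hu : IsTransmissionSolution α φ u) (hα : α ∈ Set.Icc (0 : ℝ) 1) (hφC : ∀ x, φ x ≤ C)
    (hM : ∀ t ≥ (0 : ℝ), ∀ x, |u t x| ≤ M) (hε : 0 < ε) {t₀ : ℝ} (ht₀ : 0 ≤ t₀) (x₀ : ℝ) :
    u t₀ x₀ ≤ C + ε * (1 + 2 * t₀ + (x₀ ^ 2 - |x₀|)) := by
  obtain ⟨hinit, hcont, hheat, hflux⟩ := hu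
  by_contra! hlt
  set v : ℝ × ℝ → ℝ := fun p => u p.1 p.2 - ε * (1 + 2 * p.1 + (p.2 ^ 2 - |p.2|)) with hv
  have hlt' : C < v (t₀, x₀) := by simp only [hv]; linarith
  set R : ℝ := 1 + (|M| + |C|) / ε + |x₀| with hR
  have hMC : 0 ≤ (|M| + |C|) / ε := by positivity
  have hfar : ∀ t ≥ (0 : ℝ), ∀ x, R ≤ |x| → v (t, x) ≤ C := by
    intro t ht x hx
    have h1 : (|M| + |C|) / ε ≤ x ^ 2 - |x| := by
      have h2 : (|M| + |C|) / ε ≤ |x| - 1 := by linarith [abs_nonneg x₀]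
      nlinarith [sq_abs x]
    rw [div_le_iff₀ hε] at h1
    have h3 := (abs_le.1 (hM t ht x)).2
    simp only [hv]
    nlinarith [le_abs_self M, neg_abs_le C, mul_nonneg hε.le ht]
  have hvc : ContinuousOn v (Set.Icc 0 t₀ ×ˢ Set.Icc (-R) R) := by
    refine (hcont.mono ?_).sub (Continuous.continuousOn (by fun_prop))
    exact Set.prod_mono (fun s hs => hs.1) (Set.subset_univ _)
  have hx₀ : (t₀, x₀) ∈ Set.Icc 0 t₀ ×ˢ Set.Icc (-R) R :=
    ⟨⟨ht₀, le_rfl⟩, abs_le.1 (by linarith)⟩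
  obtain ⟨⟨t, y⟩, ⟨ht, hy⟩, hmax⟩ :=
    (isCompact_Icc.prod isCompact_Icc).exists_isMaxOn ⟨_, hx₀⟩ hvc
  simp only at ht hy
  have hpos : C < v (t, y) := hlt'.trans_le (hmax hx₀)
  have htpos : 0 < t := by
    refine ht.1.lt_of_ne fun h => ?_
    subst h
    simp only [hv, hinit] at hpos
    nlinarith [hφC y, sq_abs y, sq_nonneg (|y| - 1 / 2),
      mul_nonneg hε.le (sq_nonneg (|y| - 1 / 2))]
  have hspace : ∀ x, v (t, x) ≤ v (t, y) := by
    intro x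
    rcases le_total R |x| with h | h
    · exact (hfar t ht.1 x h).trans hpos.le
    · exact hmax (show (t, x) ∈ Set.Icc 0 t₀ ×ˢ Set.Icc (-R) R from ⟨ht, abs_le.1 h⟩)
  have hspace' : ∀ x, u t x - ε * (x ^ 2 - |x|) ≤ u t y - ε * (y ^ 2 - |y|) := by
    intro x
    have := hspace x
    simp only [hv] at this
    linarith
  by_cases hy0 : y = 0
  · subst hy0
    obtain ⟨dp, dm, hp, hm, hf⟩ := hflux t htpos
    exact false_of_flux_of_touching hα hε hp hm hf fun x => by simpa using hspace' x
  · obtain ⟨hx, hs, heat⟩ := hheat t htpos y hy0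
    refine false_of_heat_of_touching hε htpos hx hs heat hspace' fun s hs => ?_
    have : v (s, y) ≤ v (t, y) := hmax (show (s, y) ∈ Set.Icc 0 t₀ ×ˢ Set.Icc (-R) R from
      ⟨⟨hs.1, hs.2.trans ht.2⟩, hy⟩)
    simp only [hv] at this
    linarith

theorem transmission_maximum_principle (α : ℝ) (hα : α ∈ Set.Icc (0 : ℝ) 1)
    (C : ℝ) (φ : ℝ → ℝ) (hφc : Continuous φ) (hφb : ∃ M, ∀ x, |φ x| ≤ M)
    (hφC : ∀ x, φ x ≤ C)
    (u : ℝ → ℝ → ℝ) (hub : ∃ M, ∀ t ≥ (0 : ℝ), ∀ x, |u t x| ≤ M)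
    (hu : IsTransmissionSolution α φ u) :
    ∀ t ≥ (0 : ℝ), ∀ x : ℝ, u t x ≤ C := by
  intro t ht x
  obtain ⟨M, hM⟩ := hub
  have hl : Tendsto (fun ε : ℝ => C + ε * (1 + 2 * t + (x ^ 2 - |x|)))
      (nhdsWithin 0 (Set.Ioi 0)) (nhds C) := by
    have : ContinuousAt (fun ε : ℝ => C + ε * (1 + 2 * t + (x ^ 2 - |x|))) 0 := by fun_prop
    simpa using this.tendsto.mono_left nhdsWithin_le_nhds
  refine ge_of_tendsto hl ?_
  filter_upwards [self_mem_nhdsWithin] with ε hε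
  exact hu.le_barrier hα hφC hM hε ht x
end

section
/- (Identification of the singular drift.) Let α ∈ [0,1]. For every continuous function ψ : ℝ → ℝ with compact support, lim_{t→0+} ∫_ℝ ψ(x)·(1/t)·(∫_ℝ q_α(t,x,y)·(y−x) dy) dx = (2α−1)·ψ(0). -/
open MeasureTheory Real Filter

/-- An odd function on the real line has zero integral. -/
theorem integral_eq_zero_of_neg_eq_neg {f : ℝ → ℝ} (hf : ∀ y, f (-y) = -f y) :
    ∫ y, f y = 0 := by
  have h := integral_neg_eq_self f volume
  simp only [hf, integral_neg] at h
  linarith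

theorem integrable_abs_mul_exp_neg_mul_sq {b : ℝ} (hb : 0 < b) :
    Integrable fun y : ℝ => |y| * exp (-b * y ^ 2) := by
  simpa [abs_mul] using (integrable_mul_exp_neg_mul_sq hb).abs

theorem exp_neg_abs_add_abs_sq_le {t : ℝ} (ht : 0 < t) (x y : ℝ) :
    exp (-(|x| + |y|) ^ 2 / (2 * t)) ≤
      exp (-(1 / (2 * t)) * x ^ 2) * exp (-(1 / (2 * t)) * y ^ 2) := by
  rw [← exp_add, exp_le_exp, ← sq_abs x, ← sq_abs y,
    show -(1 / (2 * t)) * |x| ^ 2 + -(1 / (2 * t)) * |y| ^ 2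
      = -(|x| ^ 2 + |y| ^ 2) / (2 * t) by ring]
  gcongr
  nlinarith [mul_nonneg (abs_nonneg x) (abs_nonneg y)]

theorem exp_neg_abs_add_abs_sq_le_right {t : ℝ} (ht : 0 < t) (x y : ℝ) :
    exp (-(|x| + |y|) ^ 2 / (2 * t)) ≤ exp (-(1 / (2 * t)) * y ^ 2) := by
  refine (exp_neg_abs_add_abs_sq_le ht x y).trans
    (mul_le_of_le_one_left (exp_pos _).le (exp_le_one_iff.2 ?_))
  have : 0 ≤ 1 / (2 * t) * x ^ 2 := by positivity
  linarith

theorem integral_heatKernel_mul_sub (t x : ℝ) : ∫ y, heatKernel t x y * (y - x) = 0 := by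
  rw [← integral_add_right_eq_self _ x]
  refine integral_eq_zero_of_neg_eq_neg fun y => ?_
  simp only [heatKernel]
  ring_nf

theorem integrable_heatKernel_mul_sub {t : ℝ} (ht : 0 < t) (x : ℝ) :
    Integrable fun y => heatKernel t x y * (y - x) := by
  have h := ((integrable_mul_exp_neg_mul_sq (b := 1 / (2 * t)) (by positivity)).comp_sub_right
    x).const_mul (√(2 * π * t))⁻¹
  refine h.congr (ae_of_all _ fun y => ?_)
  simp only [heatKernel]
  ring_nf

theorem integrable_abs_mul_exp_neg_abs_add_abs_sq {t : ℝ} (ht : 0 < t) (x : ℝ) :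
    Integrable fun y : ℝ => |y| * exp (-(|x| + |y|) ^ 2 / (2 * t)) := by
  refine (integrable_abs_mul_exp_neg_mul_sq (b := 1 / (2 * t)) (by positivity)).mono'
    (by fun_prop) (ae_of_all _ fun y => ?_)
  rw [norm_of_nonneg (by positivity)]
  exact mul_le_mul_of_nonneg_left (exp_neg_abs_add_abs_sq_le_right ht x y) (abs_nonneg y)

theorem integrable_sign_mul_exp_neg_abs_add_abs_sq {t : ℝ} (ht : 0 < t) (x : ℝ) :
    Integrable fun y : ℝ => Real.sign y * exp (-(|x| + |y|) ^ 2 / (2 * t)) := by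
  refine (integrable_exp_neg_mul_sq (b := 1 / (2 * t)) (by positivity)).mono'
    (measurable_real_sign.mul (by fun_prop)).aestronglyMeasurable (ae_of_all _ fun y => ?_)
  rw [norm_mul, norm_of_nonneg (exp_pos _).le]
  refine (mul_le_of_le_one_left (exp_pos _).le ?_).trans (exp_neg_abs_add_abs_sq_le_right ht x y)
  rcases Real.sign_apply_eq y with h | h | h <;> simp [h]

theorem real_sign_mul_self_eq_abs (y : ℝ) : Real.sign y * y = |y| := by
  rcases lt_trichotomy y 0 with h | rfl | h
  · simp [Real.sign_of_neg h, abs_of_neg h]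
  · simp
  · simp [Real.sign_of_pos h, abs_of_pos h]

/-- The mean displacement of Skew Brownian motion started from `x`. -/
theorem integral_skewKernel_mul_sub (α : ℝ) {t : ℝ} (ht : 0 < t) (x : ℝ) :
    ∫ y, skewKernel α t x y * (y - x) =
      (2 * α - 1) * (√(2 * π * t))⁻¹ * ∫ y : ℝ, |y| * exp (-(|x| + |y|) ^ 2 / (2 * t)) := by
  set c : ℝ := (2 * α - 1) * (√(2 * π * t))⁻¹ with hc
  have hdecomp : ∀ y, skewKernel α t x y * (y - x) = heatKernel t x y * (y - x) +
      c * (|y| * exp (-(|x| + |y|) ^ 2 / (2 * t)) -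
        x * (Real.sign y * exp (-(|x| + |y|) ^ 2 / (2 * t)))) := fun y => by
    rw [hc, skewKernel]
    linear_combination (2 * α - 1) * (√(2 * π * t))⁻¹ * exp (-(|x| + |y|) ^ 2 / (2 * t)) *
      real_sign_mul_self_eq_abs y
  have hodd : ∫ y : ℝ, Real.sign y * exp (-(|x| + |y|) ^ 2 / (2 * t)) = 0 :=
    integral_eq_zero_of_neg_eq_neg fun y => by rw [Real.sign_neg, abs_neg, neg_mul]
  have h₁ := integrable_abs_mul_exp_neg_abs_add_abs_sq ht x
  have h₂ := (integrable_sign_mul_exp_neg_abs_add_abs_sq ht x).const_mul x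
  have h₃ : Integrable fun y : ℝ => |y| * exp (-(|x| + |y|) ^ 2 / (2 * t)) -
      x * (Real.sign y * exp (-(|x| + |y|) ^ 2 / (2 * t))) := h₁.sub h₂
  simp only [hdecomp]
  rw [integral_add (integrable_heatKernel_mul_sub ht x) (h₃.const_mul c),
    integral_heatKernel_mul_sub, integral_const_mul, integral_sub h₁ h₂, integral_const_mul, hodd]
  ring

/-- Up to normalisation, the mean displacement profile of Skew Brownian motion at time one. -/
noncomputable def driftProfile (u : ℝ) : ℝ :=
  ∫ y : ℝ, |y| * exp (-(|u| + |y|) ^ 2 / 2)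

theorem integral_abs_mul_exp_eq_sq_mul_driftProfile {s : ℝ} (hs : 0 < s) (u : ℝ) :
    ∫ y : ℝ, |y| * exp (-(|s * u| + |y|) ^ 2 / (2 * s ^ 2)) = s ^ 2 * driftProfile u := by
  have h := Measure.integral_comp_mul_left
    (fun y : ℝ => |y| * exp (-(|s * u| + |y|) ^ 2 / (2 * s ^ 2))) s
  have hscale : ∀ y : ℝ, |s * y| * exp (-(|s * u| + |s * y|) ^ 2 / (2 * s ^ 2)) =
      s * (|y| * exp (-(|u| + |y|) ^ 2 / 2)) := fun y => by
    rw [abs_mul, abs_mul, abs_of_pos hs, mul_assoc]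
    congr 3
    field_simp
  simp only [hscale, integral_const_mul, smul_eq_mul, abs_of_pos (inv_pos.2 hs)] at h
  rw [driftProfile, sq s, mul_assoc, h, mul_inv_cancel_left₀ hs.ne', sq s]

theorem integrable_prod_abs_mul_exp :
    Integrable (fun p : ℝ × ℝ => |p.2| * exp (-(|p.1| + |p.2|) ^ 2 / 2))
      (volume.prod volume) := by
  have h := (integrable_exp_neg_mul_sq (b := 1 / (2 * 1)) (by norm_num)).mul_prod
    (integrable_abs_mul_exp_neg_mul_sq (b := 1 / (2 * 1)) (by norm_num))
  refine h.mono' (by fun_prop) (ae_of_all _ fun p => ?_)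
  rw [norm_of_nonneg (by positivity)]
  have := mul_le_mul_of_nonneg_left (exp_neg_abs_add_abs_sq_le one_pos p.1 p.2) (abs_nonneg p.2)
  rw [mul_one] at this
  rw [mul_one]
  linarith

theorem integrable_driftProfile : Integrable driftProfile :=
  integrable_prod_abs_mul_exp.integral_prod_left

theorem integral_abs_add_abs_mul_exp (y : ℝ) :
    ∫ x : ℝ, (|x| + |y|) * exp (-(|x| + |y|) ^ 2 / 2) = 2 * exp (-(1 / 2) * y ^ 2) := by
  rw [integral_comp_abs (f := fun r => (r + |y|) * exp (-(r + |y|) ^ 2 / 2)),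
    integral_Ioi_of_hasDerivAt_of_nonneg' (g := fun r => -exp (-(r + |y|) ^ 2 / 2)) (l := 0)]
  · simp only [zero_add, sq_abs]
    ring_nf
  · intro r _
    have h := ((((hasDerivAt_id r).add_const |y|).pow 2).neg.div_const 2).exp.neg
    convert! h using 1
    simp
    ring
  · intro r hr
    have : (0 : ℝ) < r := hr
    positivity
  · rw [← neg_zero]
    refine (tendsto_exp_atBot.comp ?_).neg
    have h : Tendsto (fun r : ℝ => (r + |y|) ^ 2 / 2) atTop atTop :=
      ((tendsto_pow_atTop two_ne_zero).comp
        (tendsto_atTop_add_const_right _ |y| tendsto_id)).atTop_div_const two_pos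
    simpa only [neg_div, Function.comp_def] using tendsto_neg_atTop_atBot.comp h

theorem integral_driftProfile : ∫ u, driftProfile u = √(2 * π) := by
  have h := integrable_prod_abs_mul_exp
  have hsym : (fun p : ℝ × ℝ => |p.2| * exp (-(|p.1| + |p.2|) ^ 2 / 2)) ∘ Prod.swap =
      fun p : ℝ × ℝ => |p.1| * exp (-(|p.1| + |p.2|) ^ 2 / 2) := by
    ext p
    simp [add_comm]
  have h' : Integrable (fun p : ℝ × ℝ => |p.1| * exp (-(|p.1| + |p.2|) ^ 2 / 2))
      (volume.prod volume) := hsym ▸ h.swap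
  have e₁ : ∫ u, driftProfile u =
      ∫ p : ℝ × ℝ, |p.2| * exp (-(|p.1| + |p.2|) ^ 2 / 2) ∂(volume.prod volume) :=
    (integral_prod _ h).symm
  have e₂ : ∫ p : ℝ × ℝ, |p.1| * exp (-(|p.1| + |p.2|) ^ 2 / 2) ∂(volume.prod volume) =
      ∫ p : ℝ × ℝ, |p.2| * exp (-(|p.1| + |p.2|) ^ 2 / 2) ∂(volume.prod volume) := by
    rw [← hsym]
    exact integral_prod_swap (μ := volume) (ν := volume)
      fun p : ℝ × ℝ => |p.2| * exp (-(|p.1| + |p.2|) ^ 2 / 2)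
  have e₃ : ∫ p : ℝ × ℝ, (|p.1| * exp (-(|p.1| + |p.2|) ^ 2 / 2) +
      |p.2| * exp (-(|p.1| + |p.2|) ^ 2 / 2)) ∂(volume.prod volume) = 2 * √(2 * π) := by
    have hadd : Integrable (fun p : ℝ × ℝ => |p.1| * exp (-(|p.1| + |p.2|) ^ 2 / 2) +
        |p.2| * exp (-(|p.1| + |p.2|) ^ 2 / 2)) (volume.prod volume) := h'.add h
    rw [integral_prod_symm _ hadd]
    simp only [← add_mul, integral_abs_add_abs_mul_exp]
    rw [integral_const_mul, integral_gaussian]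
    ring_nf
  rw [integral_add h' h, e₂, ← e₁] at e₃
  linarith

/-- The drift functional in the variable `u = x / √t`. -/
theorem integral_mul_drift_eq (α : ℝ) (ψ : ℝ → ℝ) {t : ℝ} (ht : 0 < t) :
    ∫ x, ψ x * ((1 / t) * ∫ y, skewKernel α t x y * (y - x)) =
      (2 * α - 1) * (√(2 * π))⁻¹ * ∫ u, ψ (√t * u) * driftProfile u := by
  have hs : 0 < √t := sqrt_pos.2 ht
  have hst : √t ^ 2 = t := sq_sqrt ht.le
  have h := Measure.integral_comp_mul_left
    (fun x => ψ x * ((1 / t) * ∫ y, skewKernel α t x y * (y - x))) √t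
  have hscale : ∀ u, ψ (√t * u) * ((1 / t) * ∫ y, skewKernel α t (√t * u) y * (y - √t * u)) =
      (√t)⁻¹ * ((2 * α - 1) * (√(2 * π))⁻¹ * (ψ (√t * u) * driftProfile u)) := fun u => by
    have hJ := integral_abs_mul_exp_eq_sq_mul_driftProfile hs u
    rw [hst] at hJ
    rw [integral_skewKernel_mul_sub α ht, hJ, sqrt_mul (by positivity), mul_inv]
    field_simp
  simp only [hscale, integral_const_mul, smul_eq_mul, abs_of_pos (inv_pos.2 hs)] at h
  exact (mul_left_cancel₀ (inv_pos.2 hs).ne' h).symm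

theorem skewKernel_singular_drift (α : ℝ) (hα : α ∈ Set.Icc (0 : ℝ) 1)
    (ψ : ℝ → ℝ) (hψc : Continuous ψ) (hψs : HasCompactSupport ψ) :
    Tendsto
      (fun t => ∫ x, ψ x * ((1 / t) * ∫ y, skewKernel α t x y * (y - x)))
      (nhdsWithin 0 (Set.Ioi 0)) (nhds ((2 * α - 1) * ψ 0)) := by
  obtain ⟨C, hC⟩ := hψc.bounded_above_of_compact_support hψs
  have hlim : Tendsto (fun t => ∫ u, ψ (√t * u) * driftProfile u)
      (nhdsWithin 0 (Set.Ioi 0)) (nhds (∫ u, ψ 0 * driftProfile u)) := by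
    refine tendsto_integral_filter_of_dominated_convergence (fun u => C * ‖driftProfile u‖)
      (Eventually.of_forall fun t => ?_) (Eventually.of_forall fun t => ae_of_all _ fun u => ?_)
      (integrable_driftProfile.norm.const_mul C) (ae_of_all _ fun u => ?_)
    · exact (hψc.comp (continuous_const.mul continuous_id)).aestronglyMeasurable.mul
        integrable_driftProfile.aestronglyMeasurable
    · rw [norm_mul]
      exact mul_le_mul_of_nonneg_right (hC _) (norm_nonneg _)
    · have hcont : Continuous fun t : ℝ => ψ (√t * u) * driftProfile u := by fun_prop
      simpa using (hcont.tendsto 0).mono_left nhdsWithin_le_nhds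
  rw [integral_const_mul, integral_driftProfile] at hlim
  have hpi : √(2 * π) ≠ 0 := by positivity
  have hval : (2 * α - 1) * ψ 0 = (2 * α - 1) * (√(2 * π))⁻¹ * (ψ 0 * √(2 * π)) := by
    field_simp
  rw [hval]
  refine (hlim.const_mul _).congr' ?_
  filter_upwards [self_mem_nhdsWithin] with t ht
  exact (integral_mul_drift_eq α ψ ht).symm
end

section
/- (Generalized arcsine law for the Skew Brownian motion occupation time.) Let α ∈ (0,1) and let T₁, T₂ be independent random variables, each distributed on (0,∞) with density f(s) = (1/(2√π))·s^{-3/2}·exp(−1/(4s)) (the one-sided stable law of index 1/2, with Laplace transform E[exp(−ζT)] = exp(−√ζ) for ζ > 0). Set ξ = α²T₁/(α²T₁ + (1−α)²T₂). Then for every x ∈ [0,1], P[ξ ≤ x] = (2/π)·arcsin√( x / (x + (α/(1−α))²·(1−x)) ). -/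
open MeasureTheory ProbabilityTheory Real Filter

/-- The one-sided stable law of index 1/2: the measure on `ℝ` with density
`f(s) = (1/(2√π))·s^{-3/2}·exp(-1/(4s))` on `(0,∞)` (and no mass elsewhere).
Its Laplace transform is `E[exp(-ζT)] = exp(-√ζ)`. -/
noncomputable def stableHalfLaw : Measure ℝ :=
  (volume.restrict (Set.Ioi (0 : ℝ))).withDensity
    (fun s => ENNReal.ofReal
      ((1 / (2 * Real.sqrt Real.pi)) * s ^ (-(3 : ℝ) / 2) * Real.exp (-1 / (4 * s))))

/-- The density of `stableHalfLaw` with respect to Lebesgue measure on `(0,∞)`. -/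
noncomputable def stableHalfDensity (s : ℝ) : ℝ :=
  (1 / (2 * Real.sqrt Real.pi)) * s ^ (-(3 : ℝ) / 2) * Real.exp (-1 / (4 * s))

lemma stableHalfLaw_eq : stableHalfLaw = (volume.restrict (Set.Ioi (0 : ℝ))).withDensity
    (fun s => ENNReal.ofReal (stableHalfDensity s)) := rfl

@[fun_prop]
lemma measurable_stableHalfDensity : Measurable stableHalfDensity := by
  unfold stableHalfDensity
  fun_prop

lemma stableHalfDensity_nonneg {s : ℝ} (hs : 0 < s) : 0 ≤ stableHalfDensity s := by
  unfold stableHalfDensity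
  positivity

instance : SFinite stableHalfLaw := by
  rw [stableHalfLaw_eq]
  infer_instance

lemma ae_pos_stableHalfLaw : ∀ᵐ s ∂stableHalfLaw, 0 < s :=
  (withDensity_absolutelyContinuous _ _).ae_le (ae_restrict_mem measurableSet_Ioi)

lemma stableHalfLaw_Iic (c : ℝ) :
    stableHalfLaw (Set.Iic c) = ∫⁻ s in Set.Ioc 0 c, ENNReal.ofReal (stableHalfDensity s) := by
  rw [stableHalfLaw_eq, withDensity_apply _ measurableSet_Iic,
    Measure.restrict_restrict measurableSet_Iic, Set.inter_comm, Set.Ioi_inter_Iic]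

lemma hasDerivAt_expNegInvGlue_div {A t : ℝ} (hA : 0 < A) (ht : 0 < t) :
    HasDerivAt (fun t => expNegInvGlue (t / A) / A) (t⁻¹ ^ 2 * rexp (-A / t)) t := by
  have h : HasDerivAt (fun t => rexp (-A * t⁻¹) / A)
      (rexp (-A * t⁻¹) * (-A * -(t ^ 2)⁻¹) / A) t :=
    (((hasDerivAt_inv ht.ne').const_mul (-A)).exp).div_const A
  have e : (fun t => expNegInvGlue (t / A) / A) =ᶠ[nhds t] fun t => rexp (-A * t⁻¹) / A := by
    filter_upwards [lt_mem_nhds ht] with y hy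
    have : ¬ y / A ≤ 0 := not_le.2 (div_pos hy hA)
    rw [expNegInvGlue, if_neg this, inv_div]
    congr 2
    ring
  refine (h.congr_of_eventuallyEq e).congr_deriv ?_
  rw [div_eq_mul_inv (-A) t]
  field_simp

lemma lintegral_inv_sq_mul_exp_neg_div {A : ℝ} (hA : 0 < A) :
    ∫⁻ t in Set.Ioi (0 : ℝ), ENNReal.ofReal (t⁻¹ ^ 2 * rexp (-A / t)) = ENNReal.ofReal A⁻¹ := by
  have hc : ContinuousWithinAt (fun t => expNegInvGlue (t / A) / A) (Set.Ici 0) 0 := by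
    have := (expNegInvGlue.contDiff (n := 0)).continuous
    exact (by fun_prop : Continuous fun t => expNegInvGlue (t / A) / A).continuousWithinAt
  have hd : ∀ t ∈ Set.Ioi (0 : ℝ), HasDerivAt (fun t => expNegInvGlue (t / A) / A)
      (t⁻¹ ^ 2 * rexp (-A / t)) t := fun t ht => hasDerivAt_expNegInvGlue_div hA ht
  have hp : ∀ t ∈ Set.Ioi (0 : ℝ), 0 ≤ t⁻¹ ^ 2 * rexp (-A / t) := fun t _ => by positivity
  have hl : Tendsto (fun t => expNegInvGlue (t / A) / A) atTop (nhds A⁻¹) := by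
    have h : Tendsto (fun t : ℝ => rexp (-A * t⁻¹) / A) atTop (nhds (rexp (-A * 0) / A)) :=
      ((continuous_exp.tendsto _).comp (tendsto_inv_atTop_zero.const_mul (-A))).div_const A
    rw [mul_zero, exp_zero, one_div] at h
    refine h.congr' ?_
    filter_upwards [eventually_gt_atTop 0] with y hy
    have : ¬ y / A ≤ 0 := not_le.2 (div_pos hy hA)
    rw [expNegInvGlue, if_neg this, inv_div]
    congr 2
    ring
  rw [← ofReal_integral_eq_lintegral_ofReal (integrableOn_Ioi_deriv_of_nonneg hc hd hp hl)
    (ae_restrict_of_forall_mem measurableSet_Ioi hp),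
    integral_Ioi_of_hasDerivAt_of_nonneg hc hd hp hl]
  simp [expNegInvGlue]

lemma lintegral_ratio_density {k : ℝ} (hk : 0 ≤ k) :
    ∫⁻ u in Set.Ioc 0 k, ENNReal.ofReal (1 / (π * √u * (1 + u)))
      = ENNReal.ofReal (2 / π * arctan √k) := by
  have hc : ContinuousOn (fun u => 2 / π * arctan √u) (Set.Icc 0 k) := by fun_prop
  have hd : ∀ u ∈ Set.Ioo (0 : ℝ) k,
      HasDerivAt (fun u => 2 / π * arctan √u) (1 / (π * √u * (1 + u))) u := by
    intro u hu
    refine (((hasDerivAt_sqrt hu.1.ne').arctan).const_mul (2 / π)).congr_deriv ?_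
    rw [sq_sqrt hu.1.le]
    field_simp
  have hi := intervalIntegral.integrableOn_deriv_of_nonneg hc hd fun u hu => by
    have := hu.1
    positivity
  rw [← ofReal_integral_eq_lintegral_ofReal hi
    (ae_restrict_of_forall_mem measurableSet_Ioc fun u hu => by
      have := hu.1
      positivity),
    ← intervalIntegral.integral_of_le hk,
    intervalIntegral.integral_eq_sub_of_hasDerivAt_of_le hk hc hd
      ((intervalIntegrable_iff_integrableOn_Ioc_of_le hk).2 hi)]
  simp

lemma stableHalfDensity_mul_stableHalfDensity {t u : ℝ} (ht : 0 < t) (hu : 0 < u) :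
    stableHalfDensity t * (t * stableHalfDensity (t * u))
      = 1 / (4 * π) * u ^ (-(3 : ℝ) / 2) * (t⁻¹ ^ 2 * rexp (-((1 + u⁻¹) / 4) / t)) := by
  have h1 : t ^ (-(3 : ℝ) / 2) * t ^ (-(3 : ℝ) / 2) = t⁻¹ ^ 3 := by
    rw [← rpow_add ht, show -(3 : ℝ) / 2 + -3 / 2 = -((3 : ℕ) : ℝ) by norm_num, rpow_neg ht.le,
      rpow_natCast, inv_pow]
  have h2 : rexp (-1 / (4 * t)) * rexp (-1 / (4 * (t * u))) = rexp (-((1 + u⁻¹) / 4) / t) := by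
    rw [← Real.exp_add]
    congr 1
    field_simp
    ring
  have h3 : (1 / (2 * √π)) * (1 / (2 * √π)) = 1 / (4 * π) := by
    rw [← mul_div_mul_comm, show 2 * √π * (2 * √π) = 4 * (√π * √π) by ring,
      mul_self_sqrt pi_pos.le, one_mul]
  unfold stableHalfDensity
  rw [mul_rpow ht.le hu.le]
  calc _ = (1 / (2 * √π)) * (1 / (2 * √π)) * u ^ (-(3 : ℝ) / 2)
        * (t ^ (-(3 : ℝ) / 2) * t ^ (-(3 : ℝ) / 2) * t
          * (rexp (-1 / (4 * t)) * rexp (-1 / (4 * (t * u))))) := by ring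
    _ = _ := by
      rw [h1, h2, h3]
      field_simp

lemma lintegral_stableHalfDensity_scaled {u : ℝ} (hu : 0 < u) :
    ∫⁻ t in Set.Ioi (0 : ℝ), ENNReal.ofReal (stableHalfDensity t * (t * stableHalfDensity (t * u)))
      = ENNReal.ofReal (1 / (π * √u * (1 + u))) := by
  have h : (0 : ℝ) ≤ 1 / (4 * π) * u ^ (-(3 : ℝ) / 2) := by positivity
  rw [setLIntegral_congr_fun measurableSet_Ioi (fun t ht => by
      rw [stableHalfDensity_mul_stableHalfDensity ht hu, ENNReal.ofReal_mul h]),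
    lintegral_const_mul _ (by fun_prop),
    lintegral_inv_sq_mul_exp_neg_div (by positivity), ← ENNReal.ofReal_mul h]
  congr 1
  have : u ^ (-(3 : ℝ) / 2) = (√u * u)⁻¹ := by
    rw [show -(3 : ℝ) / 2 = -(1 / 2 + 1) by norm_num, rpow_neg hu.le, rpow_add hu, rpow_one,
      sqrt_eq_rpow]
  rw [this]
  field_simp
  ring

lemma stableHalfLaw_Iic_mul {t : ℝ} (ht : 0 < t) (k : ℝ) :
    stableHalfLaw (Set.Iic (k * t))
      = ∫⁻ u in Set.Ioc 0 k, ENNReal.ofReal (t * stableHalfDensity (t * u)) := by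
  have h := lintegral_image_eq_lintegral_abs_deriv_mul (s := Set.Ioc 0 k) (f := fun u => t * u)
    (f' := fun _ => t) measurableSet_Ioc
    (fun u _ => by simpa using ((hasDerivAt_id u).const_mul t).hasDerivWithinAt)
    (mul_right_injective₀ ht.ne').injOn (fun s => ENNReal.ofReal (stableHalfDensity s))
  rw [Set.image_mul_left_Ioc ht, mul_zero, mul_comm t k] at h
  rw [stableHalfLaw_Iic, h]
  simp_rw [abs_of_pos ht, ENNReal.ofReal_mul ht.le]

/-- The ratio of two independent one-sided stable variables of index `1/2` has distribution
function `(2/π)·arctan √k`. -/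
theorem stableHalfLaw_prod_ratio_le {k : ℝ} (hk : 0 ≤ k) :
    (stableHalfLaw.prod stableHalfLaw) {p | p.1 ≤ k * p.2}
      = ENNReal.ofReal (2 / π * arctan √k) := by
  have hm : Measurable fun t : ℝ => stableHalfLaw (Set.Iic (k * t)) :=
    measurable_measure_prodMk_right (measurableSet_le measurable_fst (measurable_snd.const_mul k))
  calc (stableHalfLaw.prod stableHalfLaw) {p | p.1 ≤ k * p.2}
      = ∫⁻ t, stableHalfLaw (Set.Iic (k * t)) ∂stableHalfLaw :=
        Measure.prod_apply_symm
          (measurableSet_le measurable_fst (measurable_snd.const_mul k))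
    _ = ∫⁻ t in Set.Ioi (0 : ℝ), ENNReal.ofReal (stableHalfDensity t)
          * stableHalfLaw (Set.Iic (k * t)) := by
        conv_lhs => rw [stableHalfLaw_eq]
        exact lintegral_withDensity_eq_lintegral_mul _ (by fun_prop) hm
    _ = ∫⁻ t in Set.Ioi (0 : ℝ), ∫⁻ u in Set.Ioc 0 k,
          ENNReal.ofReal (stableHalfDensity t * (t * stableHalfDensity (t * u))) := by
        refine setLIntegral_congr_fun measurableSet_Ioi fun t ht => ?_
        simp_rw [stableHalfLaw_Iic_mul ht, ENNReal.ofReal_mul (stableHalfDensity_nonneg ht)]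
        exact (lintegral_const_mul _ (by fun_prop)).symm
    _ = ∫⁻ u in Set.Ioc 0 k, ∫⁻ t in Set.Ioi (0 : ℝ),
          ENNReal.ofReal (stableHalfDensity t * (t * stableHalfDensity (t * u))) :=
        lintegral_lintegral_swap (by fun_prop)
    _ = ∫⁻ u in Set.Ioc 0 k, ENNReal.ofReal (1 / (π * √u * (1 + u))) :=
        setLIntegral_congr_fun measurableSet_Ioc fun u hu =>
          lintegral_stableHalfDensity_scaled hu.1
    _ = _ := lintegral_ratio_density hk

lemma arctan_sqrt_eq_arcsin {k : ℝ} (hk : 0 ≤ k) : arctan √k = arcsin √(k / (1 + k)) := by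
  rw [arctan_eq_arcsin, sq_sqrt hk, sqrt_div hk]

theorem skew_generalized_arcsine_law (α : ℝ) (hα : α ∈ Set.Ioo (0 : ℝ) 1)
    {Ω : Type*} [MeasureSpace Ω] [IsProbabilityMeasure (ℙ : Measure Ω)]
    (T₁ T₂ : Ω → ℝ) (hm₁ : Measurable T₁) (hm₂ : Measurable T₂)
    (hindep : ProbabilityTheory.IndepFun T₁ T₂ (ℙ : Measure Ω))
    (hlaw₁ : Measure.map T₁ (ℙ : Measure Ω) = stableHalfLaw)
    (hlaw₂ : Measure.map T₂ (ℙ : Measure Ω) = stableHalfLaw)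
    (x : ℝ) (hx : x ∈ Set.Icc (0 : ℝ) 1) :
    (ℙ : Measure Ω) {ω | α ^ 2 * T₁ ω / (α ^ 2 * T₁ ω + (1 - α) ^ 2 * T₂ ω) ≤ x}
      = ENNReal.ofReal
        ((2 / Real.pi) *
          Real.arcsin (Real.sqrt (x / (x + (α / (1 - α)) ^ 2 * (1 - x))))) := by
  obtain ⟨hα0, hα1⟩ := hα
  have hβ : 0 < 1 - α := sub_pos.2 hα1
  have hpos₁ : ∀ᵐ ω, 0 < T₁ ω :=
    ae_of_ae_map hm₁.aemeasurable (hlaw₁ ▸ ae_pos_stableHalfLaw)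
  have hpos₂ : ∀ᵐ ω, 0 < T₂ ω :=
    ae_of_ae_map hm₂.aemeasurable (hlaw₂ ▸ ae_pos_stableHalfLaw)
  rcases hx.2.eq_or_lt with rfl | hx1
  · have h : ∀ᵐ ω, α ^ 2 * T₁ ω / (α ^ 2 * T₁ ω + (1 - α) ^ 2 * T₂ ω) ≤ 1 := by
      filter_upwards [hpos₁, hpos₂] with ω h₁ h₂
      rw [div_le_one (by positivity)]
      have : 0 < (1 - α) ^ 2 * T₂ ω := by positivity
      linarith
    rw [measure_congr (eventuallyEq_univ.2 h), measure_univ]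
    simp [pi_ne_zero]
  · have hy : 0 < 1 - x := sub_pos.2 hx1
    have hx0 := hx.1
    set k := (1 - α) ^ 2 * x / (α ^ 2 * (1 - x)) with hk
    have hk0 : 0 ≤ k := by positivity
    have hset : {ω | α ^ 2 * T₁ ω / (α ^ 2 * T₁ ω + (1 - α) ^ 2 * T₂ ω) ≤ x}
        =ᵐ[ℙ] (fun ω => (T₁ ω, T₂ ω)) ⁻¹' {p | p.1 ≤ k * p.2} := by
      rw [eventuallyEq_set]
      filter_upwards [hpos₁, hpos₂] with ω h₁ h₂
      change _ ≤ x ↔ T₁ ω ≤ k * T₂ ω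
      rw [div_le_iff₀ (by positivity), hk,
        div_mul_eq_mul_div, le_div_iff₀ (by positivity)]
      constructor <;> intro h <;> linarith
    rw [measure_congr hset, ← Measure.map_apply (hm₁.prodMk hm₂)
      (measurableSet_le measurable_fst (measurable_snd.const_mul k)),
      (indepFun_iff_map_prod_eq_prod_map_map hm₁.aemeasurable hm₂.aemeasurable).1 hindep,
      hlaw₁, hlaw₂, stableHalfLaw_prod_ratio_le hk0, arctan_sqrt_eq_arcsin hk0]
    congr 4
    have : 0 < x + (α / (1 - α)) ^ 2 * (1 - x) := by positivity
    rw [hk, div_eq_div_iff (by positivity) this.ne']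
    field_simp
    ring
end

section
/- Let α ∈ [0,1] and let (S_k)_{k≥0} be the skew random walk of parameter α started at 0. Then for every k ∈ ℕ and every integer ℓ ≥ 1, P[S_k = ℓ] = α·P[|S_k| = ℓ] and P[S_k = −ℓ] = (1−α)·P[|S_k| = ℓ]. -/
open MeasureTheory ProbabilityTheory Real Filter

/-- One-step transition probabilities of the skew random walk of parameter `α`:
from `i ≠ 0` jump to `i ± 1` with probability `1/2` each; from `0` jump to `1`
with probability `α` and to `-1` with probability `1 - α`. -/
noncomputable def skewStep (α : ℝ) (i j : ℤ) : ℝ :=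
  if i = 0 then (if j = 1 then α else if j = -1 then 1 - α else 0)
  else if j = i + 1 ∨ j = i - 1 then 1 / 2 else 0

/-- `S` is a skew random walk of parameter `α` started at `0`: its finite-dimensional
distributions are those of the trajectory measure of the Markov chain with kernel
`skewStep α` started at `0`, i.e. the probability of any finite path is the product
of the one-step transition probabilities (and the path must start at `0`). -/
def IsSkewWalk (α : ℝ) {Ω : Type*} [MeasureSpace Ω] (S : ℕ → Ω → ℤ) : Prop :=
  (∀ k, Measurable (S k)) ∧
  ∀ (k : ℕ) (s : ℕ → ℤ),
    (ℙ : Measure Ω) {ω | ∀ i ≤ k, S i ω = s i}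
      = ENNReal.ofReal
          (if s 0 = 0 then ∏ i ∈ Finset.range k, skewStep α (s i) (s (i + 1)) else 0)

theorem skewStep_nonneg {α : ℝ} (hα : α ∈ Set.Icc (0 : ℝ) 1) (i j : ℤ) : 0 ≤ skewStep α i j := by
  obtain ⟨h0, h1⟩ := hα
  unfold skewStep
  split_ifs <;> linarith

theorem measure_eq_tsum_inter_preimage_singleton {Ω β : Type*} [MeasurableSpace Ω]
    (μ : Measure Ω) [MeasurableSpace β] [MeasurableSingletonClass β] [Countable β]
    {f : Ω → β} (hf : Measurable f) (A : Set Ω) :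
    μ A = ∑' y, μ (f ⁻¹' {y} ∩ A) := by
  have h := Measure.tsum_indicator_apply_singleton ((μ.restrict A).map f) Set.univ .univ
  simp only [Set.indicator_univ, Measure.map_apply hf .univ, Set.preimage_univ,
    Measure.restrict_apply_univ, Measure.map_apply hf (measurableSet_singleton _),
    Measure.restrict_apply (hf (measurableSet_singleton _))] at h
  exact h.symm

/-- The Markov property of the skew walk at a single time. -/
theorem IsSkewWalk.measure_step {α : ℝ} (hα : α ∈ Set.Icc (0 : ℝ) 1)
    {Ω : Type*} [MeasureSpace Ω] {S : ℕ → Ω → ℤ} (hS : IsSkewWalk α S) (k : ℕ) (i j : ℤ) :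
    (ℙ : Measure Ω) {ω | S k ω = i ∧ S (k + 1) ω = j}
      = (ℙ : Measure Ω) {ω | S k ω = i} * ENNReal.ofReal (skewStep α i j) := by
  have hY : Measurable fun ω (m : Fin k) => S m ω := measurable_pi_lambda _ fun m => hS.1 m
  rw [measure_eq_tsum_inter_preimage_singleton ℙ hY,
    measure_eq_tsum_inter_preimage_singleton ℙ hY {ω | S k ω = i}, ← ENNReal.tsum_mul_right]
  refine tsum_congr fun y => ?_
  set s : ℕ → ℤ := fun m => if h : m < k then y ⟨m, h⟩ else if m = k then i else j with hs
  have hsk : s k = i := by simp [hs]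
  have hsk1 : s (k + 1) = j := by simp [hs]
  have hpast : ∀ ω, (fun m : Fin k => S m ω) = y ↔ ∀ m < k, S m ω = s m := by
    refine fun ω => ⟨?_, fun h => funext fun m => ?_⟩
    · rintro rfl m hm
      simp [hs, hm]
    · simpa [hs] using h m m.2
  have h1 : (fun ω (m : Fin k) => S m ω) ⁻¹' {y} ∩ {ω | S k ω = i}
      = {ω | ∀ m ≤ k, S m ω = s m} := by
    ext ω
    simp only [Set.mem_inter_iff, Set.mem_preimage, Set.mem_singleton_iff, Set.mem_ofPred_eq,
      hpast, ← Nat.lt_succ_iff, Nat.forall_lt_succ_right, hsk]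
  have h2 : (fun ω (m : Fin k) => S m ω) ⁻¹' {y} ∩ {ω | S k ω = i ∧ S (k + 1) ω = j}
      = {ω | ∀ m ≤ k + 1, S m ω = s m} := by
    ext ω
    simp only [Set.mem_inter_iff, Set.mem_preimage, Set.mem_singleton_iff, Set.mem_ofPred_eq,
      hpast, ← Nat.lt_succ_iff, Nat.forall_lt_succ_right, hsk, hsk1, and_assoc]
  rw [h1, h2, hS.2, hS.2, ← ENNReal.ofReal_mul' (skewStep_nonneg hα i j), ite_mul, zero_mul,
    Finset.prod_range_succ, hsk, hsk1]

/-- The one-step recursion for the marginals of the skew walk. -/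
theorem IsSkewWalk.measure_succ {α : ℝ} (hα : α ∈ Set.Icc (0 : ℝ) 1)
    {Ω : Type*} [MeasureSpace Ω] {S : ℕ → Ω → ℤ} (hS : IsSkewWalk α S) (k : ℕ) (j : ℤ) :
    (ℙ : Measure Ω) {ω | S (k + 1) ω = j}
      = (ℙ : Measure Ω) {ω | S k ω = j - 1} * ENNReal.ofReal (skewStep α (j - 1) j)
        + (ℙ : Measure Ω) {ω | S k ω = j + 1} * ENNReal.ofReal (skewStep α (j + 1) j) := by
  rw [measure_eq_tsum_inter_preimage_singleton ℙ (hS.1 k)]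
  have h : ∀ i, (ℙ : Measure Ω) (S k ⁻¹' {i} ∩ {ω | S (k + 1) ω = j})
      = (ℙ : Measure Ω) {ω | S k ω = i} * ENNReal.ofReal (skewStep α i j) :=
    fun i => hS.measure_step hα k i j
  simp only [h]
  rw [tsum_eq_sum (s := {j - 1, j + 1}), Finset.sum_pair (by omega)]
  intro i hi
  simp only [Finset.mem_insert, Finset.mem_singleton, not_or] at hi
  have h0 : skewStep α i j = 0 := by
    unfold skewStep
    split_ifs <;> first | rfl | omega
  simp [h0]

theorem IsSkewWalk.measure_balance {α : ℝ} (hα : α ∈ Set.Icc (0 : ℝ) 1)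
    {Ω : Type*} [MeasureSpace Ω] {S : ℕ → Ω → ℤ} (hS : IsSkewWalk α S) (k : ℕ) (ℓ : ℤ)
    (hℓ : 1 ≤ ℓ) :
    ENNReal.ofReal (1 - α) * (ℙ : Measure Ω) {ω | S k ω = ℓ}
      = ENNReal.ofReal α * (ℙ : Measure Ω) {ω | S k ω = -ℓ} := by
  induction k generalizing ℓ with
  | zero =>
    have h : ∀ j : ℤ, j ≠ 0 → (ℙ : Measure Ω) {ω | S 0 ω = j} = 0 := fun j hj => by
      simpa [hj] using hS.2 0 fun _ => j
    rw [h ℓ (by omega), h (-ℓ) (by omega), mul_zero, mul_zero]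
  | succ k ih =>
    have out : ∀ i j : ℤ, i ≠ 0 → (j = i + 1 ∨ j = i - 1) → skewStep α i j = 1 / 2 :=
      fun i j hi hj => by simp [skewStep, hi, hj]
    have ih_up := ih (ℓ + 1) (by omega)
    rw [neg_add'] at ih_up
    rw [hS.measure_succ hα, hS.measure_succ hα, out (ℓ + 1) ℓ (by omega) (by omega),
      out (-ℓ - 1) (-ℓ) (by omega) (by omega), mul_add, mul_add, ← mul_assoc, ← mul_assoc,
      ← mul_assoc, ← mul_assoc, ih_up, add_comm]
    congr 1
    rcases hℓ.eq_or_lt with rfl | hℓ'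
    · have h1 : skewStep α 0 1 = α := by simp [skewStep]
      have h2 : skewStep α 0 (-1) = 1 - α := by simp [skewStep]
      simp only [sub_self, neg_add_cancel, h1, h2]
      ring
    · have ih_down := ih (ℓ - 1) (by omega)
      rw [neg_sub', sub_neg_eq_add] at ih_down
      rw [out (ℓ - 1) ℓ (by omega) (by omega), out (-ℓ + 1) (-ℓ) (by omega) (by omega), ih_down]

theorem skewWalk_sign_decomposition (α : ℝ) (hα : α ∈ Set.Icc (0 : ℝ) 1)
    {Ω : Type*} [MeasureSpace Ω] [IsProbabilityMeasure (ℙ : Measure Ω)]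
    (S : ℕ → Ω → ℤ) (hS : IsSkewWalk α S) (k : ℕ) (ℓ : ℤ) (hℓ : 1 ≤ ℓ) :
    (ℙ : Measure Ω) {ω | S k ω = ℓ}
        = ENNReal.ofReal α * (ℙ : Measure Ω) {ω | |S k ω| = ℓ} ∧
      (ℙ : Measure Ω) {ω | S k ω = -ℓ}
        = ENNReal.ofReal (1 - α) * (ℙ : Measure Ω) {ω | |S k ω| = ℓ} := by
  have hsum : ENNReal.ofReal α + ENNReal.ofReal (1 - α) = 1 := by
    rw [← ENNReal.ofReal_add hα.1 (sub_nonneg.2 hα.2), add_sub_cancel, ENNReal.ofReal_one]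
  have habs : (ℙ : Measure Ω) {ω | |S k ω| = ℓ}
      = (ℙ : Measure Ω) {ω | S k ω = ℓ} + (ℙ : Measure Ω) {ω | S k ω = -ℓ} := by
    rw [← measure_union]
    · congr 1
      ext ω
      exact abs_eq (by omega)
    · refine Set.disjoint_left.2 fun ω h1 h2 => ?_
      simp only [Set.mem_ofPred_eq] at h1 h2
      omega
    · exact hS.1 k (measurableSet_singleton (-ℓ))
  have hbal := hS.measure_balance hα k ℓ hℓ
  rw [habs]
  constructor
  · rw [mul_add, ← hbal, ← add_mul, hsum, one_mul]
  · rw [mul_add, hbal, ← add_mul, hsum, one_mul]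
end
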